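/- As q tends to infinity over the primes, the normalized Gauss sums ε_χ of the nontrivial Dirichlet characters χ modulo q become equidistributed on the unit circle with respect to the uniform (Haar) probability measure: for every 0 ≤ a < b ≤ 2π and every ε > 0 there exists Q such that for every prime q ≥ Q, | (1/(q−2)) · #{χ nontrivial Dirichlet character mod q : ε_χ = e^{iθ} for some θ ∈ [a,b)} − (b−a)/(2π) | < ε. -/

import Mathlib

/-- The normalized Gauss sum `ε_χ = q^{-1/2} ∑_{x mod q} χ(x) e(x/q)` of a Dirichlet
character `χ` modulo `q`, where `e(t) = exp(2πit)` (the terms with `x` not invertible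
vanish since `χ` vanishes on non-units). -/
noncomputable def normGaussSum (q : ℕ) (χ : DirichletCharacter ℂ q) : ℂ :=
  (Real.sqrt q : ℂ)⁻¹ * ∑ x ∈ Finset.range q,
    χ (x : ZMod q) * Complex.exp (2 * (Real.pi : ℂ) * Complex.I * ((x : ℂ) / (q : ℂ)))

namespace GaussEquidist
section FiniteGroup
open scoped Classical ComplexConjugate
open Finset


/-- The unnormalized inner product on functions on a finite type. -/
noncomputable def ip {X : Type*} [Fintype X] (f g : X → ℂ) : ℂ := ∑ y, f y * conj (g y)

lemma ip_self {X : Type*} [Fintype X] (f : X → ℂ) : ip f f = ((∑ y, ‖f y‖ ^ 2 : ℝ) : ℂ) := by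
  simp [ip, Complex.mul_conj, Complex.normSq_eq_norm_sq]

lemma norm_ip_sq_le {X : Type*} [Fintype X] (f g : X → ℂ) :
    ‖ip f g‖ ^ 2 ≤ (∑ y, ‖f y‖ ^ 2) * ∑ y, ‖g y‖ ^ 2 := by
  calc ‖ip f g‖ ^ 2 ≤ (∑ y, ‖f y‖ * ‖g y‖) ^ 2 := by
        gcongr
        refine (norm_sum_le _ _).trans_eq ?_
        simp
    _ ≤ _ := Finset.sum_mul_sq_le_sq_mul_sq _ _ _

variable {G : Type*} [Group G]

/-- Extension by zero of a character of a subgroup. -/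
noncomputable def extendZero (U : Subgroup G) (η : U →* ℂ) (x : G) : ℂ :=
  if h : x ∈ U then η ⟨x, h⟩ else 0

lemma extendZero_coe (U : Subgroup G) (η : U →* ℂ) (u : U) : extendZero U η u = η u := by
  simp [extendZero]

lemma extendZero_of_notMem (U : Subgroup G) (η : U →* ℂ) {x : G} (h : x ∉ U) :
    extendZero U η x = 0 := by
  simp [extendZero, h]

lemma extendZero_mul_left (U : Subgroup G) (η : U →* ℂ) (u : U) (x : G) :
    extendZero U η (u * x) = η u * extendZero U η x := by
  by_cases h : x ∈ U
  · lift x to U using h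
    rw [← Subgroup.coe_mul, extendZero_coe, extendZero_coe, map_mul]
  · rw [extendZero_of_notMem U η h, extendZero_of_notMem, mul_zero]
    rwa [Subgroup.mul_mem_cancel_left _ u.2]

lemma extendZero_mul_right (U : Subgroup G) (η : U →* ℂ) (u : U) (x : G) :
    extendZero U η (x * u) = extendZero U η x * η u := by
  by_cases h : x ∈ U
  · lift x to U using h
    rw [← Subgroup.coe_mul, extendZero_coe, extendZero_coe, map_mul]
  · rw [extendZero_of_notMem U η h, extendZero_of_notMem, zero_mul]
    rwa [Subgroup.mul_mem_cancel_right _ u.2]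

variable [Fintype G]

/-- Convolution of two functions on a finite group. -/
noncomputable def conv (Ψ φ : G → ℂ) (x : G) : ℂ := ∑ g, Ψ g * φ (g⁻¹ * x)

lemma conv_translate {Ψ : G → ℂ} (hΨ : ∀ g h, Ψ (h * g * h⁻¹) = Ψ g) (φ : G → ℂ) (x : G) :
    conv Ψ (fun z => φ (x * z)) = fun z => conv Ψ φ (x * z) := by
  funext z
  unfold conv
  symm
  rw [← (MulAut.conj x).toEquiv.sum_comp]
  refine Finset.sum_congr rfl fun g _ => ?_
  simp only [MulEquiv.toEquiv_eq_coe, EquivLike.coe_coe, MulAut.conj_apply, hΨ]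
  congr 2
  group

lemma conv_iterate_translate {Ψ : G → ℂ} (hΨ : ∀ g h, Ψ (h * g * h⁻¹) = Ψ g) (φ : G → ℂ) (x : G)
    (n : ℕ) : (conv Ψ)^[n] (fun z => φ (x * z)) = fun z => (conv Ψ)^[n] φ (x * z) := by
  induction n generalizing φ with
  | zero => rfl
  | succ n ih => simp only [Function.iterate_succ_apply, conv_translate hΨ, ih]

lemma conv_iterate_sum {ι : Type*} (s : Finset ι) (Ψ : G → ℂ) (f : ι → G → ℂ) (n : ℕ) :
    (conv Ψ)^[n] (fun z => ∑ i ∈ s, f i z) = fun z => ∑ i ∈ s, (conv Ψ)^[n] (f i) z := by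
  induction n with
  | zero => rfl
  | succ n ih =>
    simp only [Function.iterate_succ_apply', ih]
    funext z
    simp only [conv, Finset.mul_sum]
    exact Finset.sum_comm

lemma sum_subgroup (U : Subgroup G) (f : G → ℂ) :
    ∑ u : U, f u = ∑ x, if x ∈ U then f x else 0 := by
  rw [← Finset.sum_filter]
  exact (Finset.sum_subtype _ (by simp) f).symm

lemma sum_extendZero_mul (U : Subgroup G) (η : U →* ℂ) (f : G → ℂ) :
    ∑ x, extendZero U η x * f x = ∑ u : U, η u * f u := by
  have := sum_subgroup U (fun x => extendZero U η x * f x)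
  simp only [extendZero_coe] at this
  rw [this]
  refine Finset.sum_congr rfl fun x _ => ?_
  split_ifs with h
  · rfl
  · rw [extendZero_of_notMem U η h, zero_mul]

lemma norm_hom {H : Type*} [Group H] [Finite H] (η : H →* ℂ) (u : H) : ‖η u‖ = 1 := by
  refine Complex.norm_eq_one_of_pow_eq_one (n := Nat.card H) ?_ Nat.card_pos.ne'
  rw [← map_pow, pow_card_eq_one', map_one]

lemma hom_mul_conj {H : Type*} [Group H] [Finite H] (η : H →* ℂ) (u : H) :
    η u * conj (η u) = 1 := by
  rw [Complex.mul_conj, Complex.normSq_eq_norm_sq, norm_hom]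
  simp

/-- Averaging against a character `η` of a subgroup `U`, conjugated by `p`. -/
noncomputable def rightAvg (U : Subgroup G) (η : U →* ℂ) (p : G) (a : G → ℂ) (y : G) : ℂ :=
  ∑ u : U, a (y * (p * (u : G)⁻¹ * p⁻¹)) * η u

lemma rightAvg_mul (U : Subgroup G) (η : U →* ℂ) (p : G) (a : G → ℂ) (y : G) (v : U) :
    rightAvg U η p a (y * (p * v * p⁻¹)) = η v * rightAvg U η p a y := by
  unfold rightAvg
  rw [Finset.mul_sum, ← Equiv.sum_comp (Equiv.mulRight v)]
  refine Finset.sum_congr rfl fun u _ => ?_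
  simp only [Equiv.coe_mulRight, Subgroup.coe_mul, mul_inv_rev, map_mul]
  rw [show y * (p * (v : G) * p⁻¹) * (p * ((v : G)⁻¹ * (u : G)⁻¹) * p⁻¹)
    = y * (p * (u : G)⁻¹ * p⁻¹) by group]
  ring

lemma ip_rightAvg_self (U : Subgroup G) (η : U →* ℂ) (p : G) (a : G → ℂ) :
    ip (rightAvg U η p a) (rightAvg U η p a) = Fintype.card U * ip a (rightAvg U η p a) := by
  have key : ∀ u : U, ∑ y, a (y * (p * (u : G)⁻¹ * p⁻¹)) * η u * conj (rightAvg U η p a y)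
      = ip a (rightAvg U η p a) := by
    intro u
    rw [← Equiv.sum_comp (Equiv.mulRight (p * (u : G) * p⁻¹))]
    refine Finset.sum_congr rfl fun y _ => ?_
    simp only [Equiv.coe_mulRight, rightAvg_mul, map_mul]
    rw [show y * (p * (u : G) * p⁻¹) * (p * (u : G)⁻¹ * p⁻¹) = y by group]
    linear_combination (a y * conj (rightAvg U η p a y)) * hom_mul_conj η u
  calc ip (rightAvg U η p a) (rightAvg U η p a)
      = ∑ u : U, ∑ y, a (y * (p * (u : G)⁻¹ * p⁻¹)) * η u * conj (rightAvg U η p a y) := by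
        rw [Finset.sum_comm]
        refine Finset.sum_congr rfl fun y _ => ?_
        rw [← Finset.sum_mul]
        rfl
    _ = _ := by simp [key]

lemma ip_rightAvg_eq_zero (U : Subgroup G) (η : U →* ℂ) {p p' : G} (a : G → ℂ) (u u' : U)
    (h : p * u * p⁻¹ = p' * u' * p'⁻¹) (hη : η u ≠ η u') :
    ip (rightAvg U η p a) (rightAvg U η p' a) = 0 := by
  have key : ip (rightAvg U η p a) (rightAvg U η p' a)
      = η u * conj (η u') * ip (rightAvg U η p a) (rightAvg U η p' a) := by
    conv_lhs => rw [ip, ← Equiv.sum_comp (Equiv.mulRight (p * (u : G) * p⁻¹))]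
    rw [ip, Finset.mul_sum]
    refine Finset.sum_congr rfl fun y _ => ?_
    simp only [Equiv.coe_mulRight, rightAvg_mul]
    rw [h, rightAvg_mul, map_mul]
    ring
  have h1 : η u * conj (η u') ≠ 1 := by
    intro h1
    apply hη
    linear_combination (η u') * h1 - η u * hom_mul_conj η u'
  have h2 : (1 - η u * conj (η u')) * ip (rightAvg U η p a) (rightAvg U η p' a) = 0 := by
    linear_combination key
  exact (mul_eq_zero.mp h2).resolve_left (sub_ne_zero.mpr h1.symm)

lemma sum_rightAvg_le (U : Subgroup G) (η : U →* ℂ) (P : Finset G) (a : G → ℂ)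
    (hP : ∀ p ∈ P, ∀ p' ∈ P, p ≠ p' → ∃ u u' : U, p * u * p⁻¹ = p' * u' * p'⁻¹ ∧ η u ≠ η u') :
    ∑ p ∈ P, ∑ y, ‖rightAvg U η p a y‖ ^ 2 ≤ (Fintype.card U : ℝ) ^ 2 * ∑ y, ‖a y‖ ^ 2 := by
  set f : G → ℂ := fun y => ∑ p ∈ P, rightAvg U η p a y with hf
  have h1 : ip f f = ((∑ p ∈ P, ∑ y, ‖rightAvg U η p a y‖ ^ 2 : ℝ) : ℂ) := by
    have : ip f f = ∑ p ∈ P, ∑ p' ∈ P, ip (rightAvg U η p a) (rightAvg U η p' a) := by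
      simp only [ip, hf, map_sum, Finset.sum_mul_sum]
      rw [Finset.sum_comm]
      refine Finset.sum_congr rfl fun p _ => ?_
      rw [Finset.sum_comm]
    rw [this, Complex.ofReal_sum]
    refine Finset.sum_congr rfl fun p hp => ?_
    rw [← ip_self, Finset.sum_eq_single p]
    · intro p' hp' hne
      obtain ⟨u, u', h, hη⟩ := hP p hp p' hp' hne.symm
      exact ip_rightAvg_eq_zero U η a u u' h hη
    · exact fun h => absurd hp h
  have h2 : ip f f = Fintype.card U * ip a f := by
    have : ip a f = ∑ p ∈ P, ip a (rightAvg U η p a) := by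
      simp only [ip, hf, map_sum, Finset.mul_sum]
      rw [Finset.sum_comm]
    rw [this, Finset.mul_sum, h1, Complex.ofReal_sum]
    refine Finset.sum_congr rfl fun p _ => ?_
    rw [← ip_self, ip_rightAvg_self]
  set R := ∑ p ∈ P, ∑ y, ‖rightAvg U η p a y‖ ^ 2 with hR
  have hR0 : 0 ≤ R := by positivity
  have h3 : R = ∑ y, ‖f y‖ ^ 2 := by
    rw [ip_self] at h1
    exact_mod_cast h1.symm
  have h4 : R = Fintype.card U * ‖ip a f‖ := by
    have := congrArg norm h2
    rw [h1, norm_mul, Complex.norm_real, Complex.norm_natCast, Real.norm_of_nonneg hR0] at this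
    exact this
  have h5 := norm_ip_sq_le a f
  rw [← h3] at h5
  rcases hR0.eq_or_lt with h0 | h0
  · rw [← h0]; positivity
  · refine le_of_mul_le_mul_right ?_ h0
    calc R * R = (Fintype.card U : ℝ) ^ 2 * ‖ip a f‖ ^ 2 := by rw [h4]; ring
      _ ≤ (Fintype.card U : ℝ) ^ 2 * ((∑ y, ‖a y‖ ^ 2) * R) := by gcongr
      _ = _ := by ring

/-- The number of conjugates of elements of `L` equal to a given element. -/
noncomputable def conjCount (L : Subgroup G) (g : G) : ℂ := ∑ x, if x⁻¹ * g * x ∈ L then 1 else 0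

lemma conjCount_conj (L : Subgroup G) (g h : G) :
    conjCount L (h * g * h⁻¹) = conjCount L g := by
  unfold conjCount
  rw [← Equiv.sum_comp (Equiv.mulLeft h)]
  refine Finset.sum_congr rfl fun x _ => ?_
  have : (h * x)⁻¹ * (h * g * h⁻¹) * (h * x) = x⁻¹ * g * x := by group
  simp only [Equiv.coe_mulLeft, this]

lemma rightAvg_conjCount (U L : Subgroup G) (η : U →* ℂ) (p y : G) :
    rightAvg U η p (conjCount L) y = rightAvg U η 1 (conjCount L) (p⁻¹ * y * p) := by
  unfold rightAvg
  refine Finset.sum_congr rfl fun u _ => ?_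
  rw [← conjCount_conj L _ p⁻¹]
  congr 2
  group

lemma rightAvg_conjCount_eq (U L : Subgroup G) (η : U →* ℂ) (y : G) :
    rightAvg U η 1 (conjCount L) y
      = ∑ x, ∑ l : L, extendZero U η (x * (l : G)⁻¹ * x⁻¹ * y) := by
  have h1 : rightAvg U η 1 (conjCount L) y
      = ∑ g, extendZero U η g * conjCount L (y * g⁻¹) := by
    rw [sum_extendZero_mul]
    exact Finset.sum_congr rfl fun u _ => by rw [mul_comm]; simp
  simp only [h1, conjCount, Finset.mul_sum]
  rw [Finset.sum_comm]
  refine Finset.sum_congr rfl fun x _ => ?_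
  rw [sum_subgroup L (fun l => extendZero U η (x * (l : G)⁻¹ * x⁻¹ * y))]
  rw [← (MulAut.conj x⁻¹).toEquiv.sum_comp
    (fun l => if l ∈ L then extendZero U η (x * (l : G)⁻¹ * x⁻¹ * y) else 0)]
  rw [← ((Equiv.inv G).trans (Equiv.mulRight y)).sum_comp]
  refine Finset.sum_congr rfl fun g _ => ?_
  simp only [Equiv.trans_apply, Equiv.inv_apply, Equiv.coe_mulRight, MulEquiv.toEquiv_eq_coe,
    EquivLike.coe_coe, MulAut.conj_apply, mul_ite, mul_one, mul_zero, inv_inv]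
  rw [show x⁻¹ * (y * (g⁻¹ * y)⁻¹) * x = x⁻¹ * g * x by group,
    show x * (x⁻¹ * g * x)⁻¹ * x⁻¹ * y = g⁻¹ * y by group]

lemma conv_iterate_of_torus {T : Type*} [CommGroup T] [Fintype T] (L : Subgroup G) (d : T →* G)
    (w : T → ℂ) {Ψ : G → ℂ} (hΨ : ∀ g h, Ψ (h * g * h⁻¹) = Ψ g)
    (hconv : ∀ b : G → ℂ, (∀ l : L, ∀ z, b (l * z) = b z) →
      ∀ z, conv Ψ b z = Fintype.card L * ∑ t, w t * b ((d t)⁻¹ * z))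
    (b : G → ℂ) (hb : ∀ l : L, ∀ z, b (l * z) = b z) (n : ℕ) (z : G) :
    (conv Ψ)^[n] b z
      = (Fintype.card L : ℂ) ^ n * ∑ t, (conv w)^[n] (Pi.single 1 1) t * b ((d t)⁻¹ * z) := by
  induction n generalizing z with
  | zero => simp [Pi.single_apply]
  | succ n ih =>
    rw [Function.iterate_succ_apply', hconv]
    · have h1 : ∀ s t : T, (d (s * t))⁻¹ * z = (d t)⁻¹ * ((d s)⁻¹ * z) := by
        intro s t
        rw [map_mul]
        group
      have h2 : ∀ s : T, ∑ t, (conv w)^[n] (Pi.single 1 1) t * b ((d t)⁻¹ * ((d s)⁻¹ * z))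
          = ∑ t, (conv w)^[n] (Pi.single 1 1) (s⁻¹ * t) * b ((d t)⁻¹ * z) := by
        intro s
        rw [← Equiv.sum_comp (Equiv.mulLeft s)
          (fun t => (conv w)^[n] (Pi.single 1 1) (s⁻¹ * t) * b ((d t)⁻¹ * z))]
        simp only [Equiv.coe_mulLeft, inv_mul_cancel_left, h1]
      simp only [ih, h2, Function.iterate_succ_apply']
      rw [pow_succ', mul_assoc]
      congr 1
      simp only [Finset.mul_sum]
      rw [Finset.sum_comm]
      refine Finset.sum_congr rfl fun t _ => ?_
      rw [conv, Finset.sum_mul, Finset.mul_sum]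
      exact Finset.sum_congr rfl fun s _ => by ring
    · intro l z
      have := conv_iterate_translate hΨ b l n
      have hb' : (fun z => b (l * z)) = b := funext (hb l)
      rw [hb'] at this
      exact (congrFun this z).symm

lemma sum_extendZero_mul_conj (U : Subgroup G) (η : U →* ℂ) (a : G) :
    ∑ g, extendZero U η (a * g) * conj (extendZero U η g)
      = Fintype.card U * extendZero U η a := by
  have h := sum_subgroup U (fun g => extendZero U η (a * g) * conj (extendZero U η g))
  have h1 : ∀ g, (if g ∈ U then extendZero U η (a * g) * conj (extendZero U η g) else 0)
      = extendZero U η (a * g) * conj (extendZero U η g) := by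
    intro g
    split_ifs with hg
    · rfl
    · rw [extendZero_of_notMem U η hg, map_zero, mul_zero]
  simp only [h1, extendZero_mul_right, extendZero_coe, mul_assoc, hom_mul_conj] at h
  rw [← h]
  simp

lemma ip_conv_conjCount {T : Type*} [CommGroup T] [Fintype T] (U L : Subgroup G) (η : U →* ℂ)
    (d : T →* G) (w : T → ℂ) {Ψ : G → ℂ} (hΨ : ∀ g h, Ψ (h * g * h⁻¹) = Ψ g)
    (hconv : ∀ b : G → ℂ, (∀ l : L, ∀ z, b (l * z) = b z) →
      ∀ z, conv Ψ b z = Fintype.card L * ∑ t, w t * b ((d t)⁻¹ * z))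
    (hd : ∀ x, ∀ l : L, ∀ t, x * (l * (d t)⁻¹) * x⁻¹ ∈ U → t = 1) (n : ℕ) :
    ip ((conv Ψ)^[n] (extendZero U η)) (rightAvg U η 1 (conjCount L))
      = (Fintype.card L : ℂ) ^ n * (conv w)^[n] (Pi.single 1 1) 1
        * (Fintype.card U * ∑ x, ∑ l : L, extendZero U η (x * l * x⁻¹)) := by
  set W := (conv Ψ)^[n] (extendZero U η) with hW
  have h1 : ip W (rightAvg U η 1 (conjCount L))
      = ∑ x, ∑ z, (∑ l : L, W (x * l * z)) * conj (extendZero U η (x * z)) := by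
    simp only [ip, rightAvg_conjCount_eq, map_sum, Finset.mul_sum, Finset.sum_mul]
    rw [Finset.sum_comm]
    refine Finset.sum_congr rfl fun x _ => ?_
    rw [Finset.sum_comm]
    conv_rhs => rw [Finset.sum_comm]
    refine Finset.sum_congr rfl fun l _ => ?_
    rw [← Equiv.sum_comp (Equiv.mulLeft (x * (l : G)))]
    refine Finset.sum_congr rfl fun z _ => ?_
    simp only [Equiv.coe_mulLeft]
    rw [show x * (l : G)⁻¹ * x⁻¹ * (x * l * z) = x * z by group]
  have h2 : ∀ x z, ∑ l : L, W (x * l * z) = (Fintype.card L : ℂ) ^ n *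
      ∑ t, (conv w)^[n] (Pi.single 1 1) t
        * ∑ l : L, extendZero U η (x * l * ((d t)⁻¹ * z)) := by
    intro x z
    have := conv_iterate_of_torus L d w hΨ hconv
      (fun z => ∑ l : L, extendZero U η (x * l * z)) ?_ n z
    · rw [← this, conv_iterate_sum]
      refine Finset.sum_congr rfl fun l _ => ?_
      rw [conv_iterate_translate hΨ]
    · intro l z
      rw [← Equiv.sum_comp (Equiv.mulRight l⁻¹)]
      refine Finset.sum_congr rfl fun m _ => ?_
      simp only [Equiv.coe_mulRight, Subgroup.coe_mul, Subgroup.coe_inv]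
      congr 1
      group
  have h3 : ∀ x z, (∑ t, (conv w)^[n] (Pi.single 1 1) t
        * ∑ l : L, extendZero U η (x * l * ((d t)⁻¹ * z))) * conj (extendZero U η (x * z))
      = (conv w)^[n] (Pi.single 1 1) 1
        * ∑ l : L, extendZero U η (x * l * z) * conj (extendZero U η (x * z)) := by
    intro x z
    rw [Finset.sum_mul, Finset.sum_eq_single 1]
    · rw [mul_assoc, Finset.sum_mul]
      simp
    · intro t _ ht
      by_cases hz : x * z ∈ U
      · rw [Finset.sum_eq_zero, mul_zero, zero_mul]
        intro l _
        refine extendZero_of_notMem U η fun hmem => ht (hd x l t ?_)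
        have := U.mul_mem hmem (U.inv_mem hz)
        convert this using 1
        group
      · rw [extendZero_of_notMem U η hz, map_zero, mul_zero]
    · simp
  rw [h1]
  simp only [h2, mul_assoc _ _ (conj _), h3]
  simp only [← Finset.mul_sum]
  rw [mul_assoc]
  congr 2
  rw [Finset.mul_sum]
  refine Finset.sum_congr rfl fun x _ => ?_
  rw [Finset.sum_comm, Finset.mul_sum]
  refine Finset.sum_congr rfl fun l _ => ?_
  rw [← sum_extendZero_mul_conj, ← Equiv.sum_comp (Equiv.mulLeft x⁻¹)]
  refine Finset.sum_congr rfl fun g _ => ?_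
  simp only [Equiv.coe_mulLeft, mul_assoc, mul_inv_cancel_left]

lemma sum_extendZero_conj_re_nonneg (U L : Subgroup G) (η : U →* ℂ) (x : G) :
    0 ≤ (∑ l : L, extendZero U η (x * l * x⁻¹)).re := by
  let H : Subgroup G := L ⊓ U.comap (MulAut.conj x).toMonoidHom
  let f : H →* U := ((MulAut.conj x).toMonoidHom.comp H.subtype).codRestrict U fun h => h.2.2
  have h1 : ∑ l : L, extendZero U η (x * l * x⁻¹) = ∑ h : H, η (f h) := by
    have h2 : ∀ h : H, η (f h) = extendZero U η (x * h * x⁻¹) := fun h =>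
      (extendZero_coe U η (f h)).symm
    simp only [h2]
    rw [sum_subgroup L (fun l => extendZero U η (x * l * x⁻¹)),
      sum_subgroup H (fun l => extendZero U η (x * l * x⁻¹))]
    refine Finset.sum_congr rfl fun g _ => ?_
    by_cases hg : x * g * x⁻¹ ∈ U
    · have : g ∈ H ↔ g ∈ L := ⟨fun h => h.1, fun h => ⟨h, hg⟩⟩
      simp [this]
    · simp [extendZero_of_notMem U η hg]
  rw [h1]
  have := sum_hom_units (η.comp f)
  simp only [MonoidHom.comp_apply] at this
  rw [this]
  split_ifs <;> simp

lemma card_le_norm_sum_extendZero (U L : Subgroup G) (η : U →* ℂ) (A : Finset G)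
    (hA : ∀ x ∈ A, ∀ l : L, x * l * x⁻¹ ∈ U → l = 1) :
    (A.card : ℝ) ≤ ‖∑ x, ∑ l : L, extendZero U η (x * l * x⁻¹)‖ := by
  refine le_trans ?_ (Complex.re_le_norm _)
  rw [Complex.re_sum]
  calc (A.card : ℝ) = ∑ x ∈ A, (1 : ℝ) := by simp
    _ = ∑ x ∈ A, (∑ l : L, extendZero U η (x * l * x⁻¹)).re := by
        refine Finset.sum_congr rfl fun x hx => ?_
        rw [Finset.sum_eq_single 1]
        · have := extendZero_coe U η 1
          simp only [OneMemClass.coe_one, map_one] at this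
          simp [this]
        · intro l _ hl
          exact extendZero_of_notMem U η fun h => hl (hA x hx l h)
        · simp
    _ ≤ _ := Finset.sum_le_univ_sum_of_nonneg fun x => sum_extendZero_conj_re_nonneg U L η x

lemma sum_norm_conjCount_sq (L : Subgroup G) :
    ∑ g, ‖conjCount L g‖ ^ 2
      = Fintype.card G * (univ.filter fun p : G × L => p.1 * p.2 * p.1⁻¹ ∈ L).card := by
  have h0 : ((∑ g, ‖conjCount L g‖ ^ 2 : ℝ) : ℂ)
      = Fintype.card G * (univ.filter fun p : G × L => p.1 * p.2 * p.1⁻¹ ∈ L).card := by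
    rw [← ip_self, ip, Finset.card_filter, Fintype.sum_prod_type]
    simp only [conjCount, map_sum, Finset.sum_mul]
    rw [Finset.sum_comm]
    have h1 : ∀ x : G, ∑ g, (if x⁻¹ * g * x ∈ L then (1 : ℂ) else 0)
          * ∑ y, conj (if y⁻¹ * g * y ∈ L then (1 : ℂ) else 0)
        = ∑ z : G, ∑ l : L, if z * l * z⁻¹ ∈ L then (1 : ℂ) else 0 := by
      intro x
      simp only [Finset.mul_sum]
      rw [Finset.sum_comm, ← Equiv.sum_comp ((Equiv.inv G).trans (Equiv.mulLeft x))]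
      refine Finset.sum_congr rfl fun z _ => ?_
      rw [sum_subgroup L (fun l => if z * l * z⁻¹ ∈ L then (1 : ℂ) else 0)]
      rw [← (MulAut.conj x).toEquiv.sum_comp]
      refine Finset.sum_congr rfl fun g _ => ?_
      have e1 : x⁻¹ * (x * g * x⁻¹) * x = g := by group
      have e2 : (x * z⁻¹)⁻¹ * (x * g * x⁻¹) * (x * z⁻¹) = z * g * z⁻¹ := by group
      simp only [Equiv.trans_apply, Equiv.inv_apply, Equiv.coe_mulLeft, MulEquiv.toEquiv_eq_coe,
        EquivLike.coe_coe, MulAut.conj_apply, e1, e2]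
      split_ifs <;> simp
    simp only [h1]
    simp
  exact_mod_cast h0

end FiniteGroup
end GaussEquidist

namespace GaussEquidist
section Unitriangular
open scoped Classical ComplexConjugate
open Finset Matrix

variable {F : Type*} [Field F] {N : ℕ}

/-- The invertible diagonal matrices. -/
noncomputable def torus : (Fin N → Fˣ) →* GL (Fin N) F :=
  (Units.map (Matrix.diagonalRingHom (Fin N) F).toMonoidHom).comp
    MulEquiv.piUnits.symm.toMonoidHom

lemma coe_torus (t : Fin N → Fˣ) :
    (torus t : Matrix (Fin N) (Fin N) F) = Matrix.diagonal fun i => (t i : F) := rfl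

lemma torus_mul_apply (t : Fin N → Fˣ) (g : GL (Fin N) F) (i j : Fin N) :
    (torus t * g : GL (Fin N) F) i j = t i * g i j := by
  rw [Units.val_mul, coe_torus, Matrix.diagonal_mul]

lemma mul_torus_apply (t : Fin N → Fˣ) (g : GL (Fin N) F) (i j : Fin N) :
    (g * torus t : GL (Fin N) F) i j = g i j * t j := by
  rw [Units.val_mul, coe_torus, Matrix.mul_diagonal]

/-- The class function `g ↦ ψ (tr g)`. -/
noncomputable def traceChar (ψ : AddChar F ℂ) (g : GL (Fin N) F) : ℂ := ψ g.val.trace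

lemma traceChar_conj (ψ : AddChar F ℂ) (g h : GL (Fin N) F) :
    traceChar ψ (h * g * h⁻¹) = traceChar ψ g := by
  unfold traceChar
  rw [Units.val_mul, Matrix.trace_mul_comm, ← Units.val_mul, inv_mul_cancel_left]

/-- The unipotent matrix with given off-diagonal entries. -/
noncomputable def uniMat (r : Fin N → Fin N → Prop) (f : {p : Fin N × Fin N // r p.1 p.2} → F) :
    Matrix (Fin N) (Fin N) F :=
  1 + Matrix.of fun i j => if h : r i j then f ⟨(i, j), h⟩ else 0

lemma trace_mul_uniMat (r : Fin N → Fin N → Prop) (m : Matrix (Fin N) (Fin N) F)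
    (f : {p : Fin N × Fin N // r p.1 p.2} → F) :
    (m * uniMat r f).trace = m.trace + ∑ p, m p.1.2 p.1.1 * f p := by
  rw [uniMat, mul_add, mul_one, Matrix.trace_add]
  congr 1
  simp only [Matrix.trace, Matrix.diag_apply, Matrix.mul_apply, Matrix.of_apply]
  rw [← Finset.sum_product', Finset.univ_product_univ]
  have : ∀ p : {p : Fin N × Fin N // r p.1 p.2}, m p.1.2 p.1.1 * f p
      = (fun p : Fin N × Fin N => m p.2 p.1 * if h : r p.1 p.2 then f ⟨p, h⟩ else 0) p := by
    intro p
    simp [p.2]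
  simp only [this]
  rw [← Finset.sum_subtype (univ.filter fun p : Fin N × Fin N => r p.1 p.2) (by simp)
    (fun p : Fin N × Fin N => m p.2 p.1 * if h : r p.1 p.2 then f ⟨p, h⟩ else 0),
    Finset.sum_filter, ← Equiv.sum_comp (Equiv.prodComm _ _)]
  refine Finset.sum_congr rfl fun p _ => ?_
  by_cases h : r p.1 p.2 <;> simp [h]

lemma det_uniMat (r : Fin N → Fin N → Prop)
    (hr : (∀ i j, r i j → i < j) ∨ ∀ i j, r i j → j < i)
    (f : {p : Fin N × Fin N // r p.1 p.2} → F) : (uniMat r f).det = 1 := by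
  have hdiag : ∀ i, uniMat r f i i = 1 := by
    intro i
    have : ¬ r i i := by
      rcases hr with hr | hr <;> exact fun h => lt_irrefl _ (hr i i h)
    simp [uniMat, this]
  rcases hr with hr | hr
  · rw [Matrix.det_of_isUpperTriangular]
    · simp [hdiag]
    · intro i j hij
      have h1 : j < i := hij
      have : ¬ r i j := fun h => lt_asymm h1 (hr i j h)
      simp [uniMat, this, h1.ne']
  · rw [Matrix.det_of_isLowerTriangular]
    · simp [hdiag]
    · intro i j hij
      have h1 : i < j := hij
      have : ¬ r i j := fun h => lt_asymm h1 (hr i j h)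
      simp [uniMat, this, h1.ne]

/-- The unipotent matrices attached to a strict partial order on the index set, as a monoid. -/
def uniMonoid (F : Type*) [Field F] {N : ℕ} (r : Fin N → Fin N → Prop)
    [IsStrictOrder (Fin N) r] : Submonoid (GL (Fin N) F) where
  carrier := {g | ∀ i j, ¬ r i j → g i j = (1 : Matrix (Fin N) (Fin N) F) i j}
  one_mem' := fun _ _ _ => rfl
  mul_mem' := by
    intro g h hg hh i j hij
    have e : (g * h : GL (Fin N) F) i j = (1 : Matrix (Fin N) (Fin N) F) i j
        + (g.val - 1) i j + (h.val - 1) i j + ((g.val - 1) * (h.val - 1)) i j := by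
      rw [Units.val_mul]
      have : g.val * h.val = 1 + (g.val - 1) + (h.val - 1) + (g.val - 1) * (h.val - 1) := by
        noncomm_ring
      rw [this]
      rfl
    rw [e, Matrix.sub_apply, Matrix.sub_apply, hg i j hij, hh i j hij, Matrix.mul_apply,
      Finset.sum_eq_zero]
    · simp
    · intro k _
      by_cases hik : r i k
      · by_cases hkj : r k j
        · exact absurd (_root_.trans hik hkj) hij
        · rw [Matrix.sub_apply h.val, hh k j hkj, sub_self, mul_zero]
      · rw [Matrix.sub_apply, hg i k hik, sub_self, zero_mul]

/-- The unipotent matrices attached to a strict partial order on the index set. -/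
def uni (F : Type*) [Field F] [Finite F] {N : ℕ} (r : Fin N → Fin N → Prop)
    [IsStrictOrder (Fin N) r] : Subgroup (GL (Fin N) F) where
  __ := uniMonoid F r
  inv_mem' := by
    intro g hg
    have : g⁻¹ = g ^ (Nat.card (GL (Fin N) F) - 1) := by
      refine inv_eq_of_mul_eq_one_right ?_
      rw [← pow_succ', Nat.sub_add_cancel Nat.card_pos, pow_card_eq_one']
    rw [this]
    exact pow_mem (S := uniMonoid F r) hg _

variable [Fintype F]

lemma uni_apply_self {r : Fin N → Fin N → Prop} [IsStrictOrder (Fin N) r] {g : GL (Fin N) F}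
    (hg : g ∈ uni F r) (i : Fin N) : g i i = 1 := by
  rw [hg i i (irrefl i), Matrix.one_apply_eq]

lemma uni_apply_of_not {r : Fin N → Fin N → Prop} [IsStrictOrder (Fin N) r] {g : GL (Fin N) F}
    (hg : g ∈ uni F r) {i j : Fin N} (hij : ¬ r i j) (hne : i ≠ j) : g i j = 0 := by
  rw [hg i j hij, Matrix.one_apply_ne hne]

/-- Coordinates on a unipotent group. -/
noncomputable def uniEquiv (r : Fin N → Fin N → Prop) [IsStrictOrder (Fin N) r]
    (hr : (∀ i j, r i j → i < j) ∨ ∀ i j, r i j → j < i) :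
    ({p : Fin N × Fin N // r p.1 p.2} → F) ≃ uni F r where
  toFun f := ⟨Matrix.GeneralLinearGroup.mk'' (uniMat r f) (by simp [det_uniMat r hr f]), by
    intro i j hij
    change uniMat r f i j = _
    simp [uniMat, hij]⟩
  invFun u := fun p => u.1 p.1.1 p.1.2
  left_inv f := by
    funext p
    have hne : p.1.1 ≠ p.1.2 := fun h => irrefl (r := r) _ (h ▸ p.2 : r p.1.1 p.1.1)
    change uniMat r f p.1.1 p.1.2 = _
    simp [uniMat, hne, p.2]
  right_inv u := by
    apply Subtype.ext
    apply Units.ext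
    ext i j
    change uniMat r (fun p => u.1 p.1.1 p.1.2) i j = u.1 i j
    by_cases h : r i j
    · have hne : i ≠ j := fun h' => irrefl (r := r) _ (h' ▸ h : r i i)
      simp [uniMat, hne, h]
    · rw [u.2 i j h]
      simp [uniMat, h]

lemma coe_uniEquiv (r : Fin N → Fin N → Prop) [IsStrictOrder (Fin N) r]
    (hr : (∀ i j, r i j → i < j) ∨ ∀ i j, r i j → j < i)
    (f : {p : Fin N × Fin N // r p.1 p.2} → F) :
    ((uniEquiv r hr f : GL (Fin N) F) : Matrix (Fin N) (Fin N) F) = uniMat r f := rfl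

lemma card_uni (r : Fin N → Fin N → Prop) [IsStrictOrder (Fin N) r]
    (hr : (∀ i j, r i j → i < j) ∨ ∀ i j, r i j → j < i) :
    Fintype.card (uni F r) = Fintype.card F ^ #{p : Fin N × Fin N | r p.1 p.2} := by
  rw [← Fintype.card_congr (uniEquiv (F := F) r hr), Fintype.card_fun, Fintype.card_subtype]

lemma sum_uni_trace (r : Fin N → Fin N → Prop) [IsStrictOrder (Fin N) r]
    (hr : (∀ i j, r i j → i < j) ∨ ∀ i j, r i j → j < i) {ψ : AddChar F ℂ} (hψ : ψ ≠ 0)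
    (m : Matrix (Fin N) (Fin N) F) :
    ∑ u : uni F r, ψ (m * (u : GL (Fin N) F).val).trace
      = if ∀ i j, r i j → m j i = 0 then Fintype.card (uni F r) * ψ m.trace else 0 := by
  let ℓ : ({p : Fin N × Fin N // r p.1 p.2} → F) →+ F :=
    { toFun := fun f => ∑ p, m p.1.2 p.1.1 * f p
      map_zero' := by simp
      map_add' := fun f g => by simp [mul_add, Finset.sum_add_distrib] }
  have hℓ : ∀ f, ℓ f = ∑ p, m p.1.2 p.1.1 * f p := fun _ => rfl
  rw [← Equiv.sum_comp (uniEquiv (F := F) r hr), ← Fintype.card_congr (uniEquiv (F := F) r hr)]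
  have h1 : ∀ f, ψ (m * (uniEquiv r hr f : GL (Fin N) F).val).trace
      = ψ m.trace * (ψ.compAddMonoidHom ℓ) f := by
    intro f
    rw [coe_uniEquiv, trace_mul_uniMat, AddChar.map_add_eq_mul]
    rfl
  simp only [h1]
  rw [← Finset.mul_sum, AddChar.sum_eq_ite]
  have h2 : ψ.compAddMonoidHom ℓ = 0 ↔ ∀ i j, r i j → m j i = 0 := by
    constructor
    · intro h i j hij
      by_contra hne
      obtain ⟨a, ha⟩ := (AddChar.ne_one_iff (ψ := ψ)).mp hψ
      apply ha
      have := DFunLike.congr_fun h (Pi.single ⟨(i, j), hij⟩ ((m j i)⁻¹ * a))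
      simpa [AddChar.compAddMonoidHom_apply, hℓ, Pi.single_apply, hne] using this
    · intro h
      ext f
      have : ℓ f = 0 := by
        rw [hℓ]
        exact Finset.sum_eq_zero fun p _ => by rw [h _ _ p.2, zero_mul]
      simp [AddChar.compAddMonoidHom_apply, this]
  simp only [h2]
  split_ifs <;> ring

lemma conv_traceChar_of_equivariant (r : Fin N → Fin N → Prop) [IsStrictOrder (Fin N) r]
    (hr : (∀ i j, r i j → i < j) ∨ ∀ i j, r i j → j < i) {ψ : AddChar F ℂ} (hψ : ψ ≠ 0)
    (m : Matrix (Fin N) (Fin N) F) (φ : GL (Fin N) F → ℂ)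
    (hφ : ∀ u : uni F r, ∀ y, φ ((u : GL (Fin N) F)⁻¹ * y) = ψ (-(m * u.1.val).trace) * φ y)
    (x : GL (Fin N) F) :
    conv (traceChar ψ) φ x = ∑ g : GL (Fin N) F,
      if ∀ i j, r i j → g j i = m j i then ψ (g.val.trace - m.trace) * φ (g⁻¹ * x) else 0 := by
  have hcard : (Fintype.card (uni F r) : ℂ) ≠ 0 := Nat.cast_ne_zero.mpr Fintype.card_ne_zero
  refine mul_left_cancel₀ hcard ?_
  calc (Fintype.card (uni F r) : ℂ) * conv (traceChar ψ) φ x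
      = ∑ u : uni F r, ∑ g : GL (Fin N) F,
          ψ ((g.val - m) * u.1.val).trace * φ (g⁻¹ * x) := by
        rw [← nsmul_eq_mul, ← Finset.card_univ, ← Finset.sum_const]
        refine Finset.sum_congr rfl fun u _ => ?_
        rw [conv, ← Equiv.sum_comp (Equiv.mulRight (u : GL (Fin N) F))]
        refine Finset.sum_congr rfl fun g _ => ?_
        rw [Equiv.coe_mulRight, _root_.mul_inv_rev, mul_assoc, hφ, traceChar, ← mul_assoc,
          ← AddChar.map_add_eq_mul, Units.val_mul, sub_mul, Matrix.trace_sub, sub_eq_add_neg]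
    _ = _ := by
        rw [Finset.sum_comm, Finset.mul_sum]
        refine Finset.sum_congr rfl fun g _ => ?_
        rw [← Finset.sum_mul, sum_uni_trace r hr hψ]
        simp only [Matrix.sub_apply, sub_eq_zero, Matrix.trace_sub]
        split_ifs <;> ring

end Unitriangular
end GaussEquidist

namespace GaussEquidist
section Torus
open scoped Classical ComplexConjugate
open Finset Matrix

variable {F : Type*} [Field F] {N : ℕ}

lemma addChar_map_sum {ι : Type*} (s : Finset ι) (ψ : AddChar F ℂ) (f : ι → F) :
    ψ (∑ i ∈ s, f i) = ∏ i ∈ s, ψ (f i) := by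
  induction s using Finset.induction_on with
  | empty => simp
  | insert a s ha ih =>
    rw [Finset.sum_insert ha, Finset.prod_insert ha, AddChar.map_add_eq_mul, ih]

lemma torus_conj_apply (s t : Fin N → Fˣ) (l : GL (Fin N) F) (i j : Fin N) :
    (torus s * l * (torus t)⁻¹) i j = s i * l i j * ((t j)⁻¹ : Fˣ) := by
  rw [← map_inv, mul_torus_apply, torus_mul_apply]
  rfl

variable [Fintype F]

lemma exists_torus_inv_mul_mem (g : GL (Fin N) F) (hg : ∀ i j, i < j → g i j = 0) :
    ∃ t, (torus t)⁻¹ * g ∈ uni F (N := N) (· > ·) := by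
  have hdet : g.val.det ≠ 0 := ((Matrix.isUnit_iff_isUnit_det _).mp g.isUnit).ne_zero
  rw [Matrix.det_of_isLowerTriangular g.val (fun i j hij => hg i j hij),
    Finset.prod_ne_zero_iff] at hdet
  refine ⟨fun i => Units.mk0 (g i i) (hdet i (mem_univ i)), fun i j hij => ?_⟩
  rw [← map_inv, torus_mul_apply]
  rcases eq_or_ne i j with rfl | hne
  · simp [hdet i (mem_univ i)]
  · rw [hg i j (lt_of_le_of_ne (not_lt.mp hij) hne), mul_zero, Matrix.one_apply_ne hne]

lemma torus_mul_uni_apply_self (t : Fin N → Fˣ) {l : GL (Fin N) F}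
    (hl : l ∈ uni F (N := N) (· > ·)) (i : Fin N) : (torus t * l) i i = t i := by
  rw [torus_mul_apply, uni_apply_self hl, mul_one]

lemma uni_apply_of_lt {l : GL (Fin N) F} (hl : l ∈ uni F (N := N) (· > ·)) {i j : Fin N}
    (hij : i < j) : l i j = 0 :=
  uni_apply_of_not hl (lt_asymm hij) hij.ne

lemma torus_mul_uni_apply_of_lt (t : Fin N → Fˣ) {l : GL (Fin N) F}
    (hl : l ∈ uni F (N := N) (· > ·)) {i j : Fin N} (hij : i < j) : (torus t * l) i j = 0 := by
  rw [torus_mul_apply, uni_apply_of_lt hl hij, mul_zero]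

lemma torus_mul_uni_injective {t t' : Fin N → Fˣ} {l l' : GL (Fin N) F}
    (hl : l ∈ uni F (N := N) (· > ·)) (hl' : l' ∈ uni F (N := N) (· > ·))
    (h : torus t * l = torus t' * l') : t = t' ∧ l = l' := by
  have ht : t = t' := by
    funext i
    apply Units.ext
    rw [← torus_mul_uni_apply_self t hl, h, torus_mul_uni_apply_self t' hl']
  subst ht
  exact ⟨rfl, mul_left_cancel h⟩

lemma sum_lower (f : GL (Fin N) F → ℂ) :
    (∑ g : GL (Fin N) F, if ∀ i j : Fin N, i > j → g j i = 0 then f g else 0)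
      = ∑ t, ∑ l : uni F (N := N) (· > ·), f (torus t * (l : GL (Fin N) F)) := by
  have h1 : ∀ t : Fin N → Fˣ, ∑ l : uni F (N := N) (· > ·), f (torus t * (l : GL (Fin N) F))
      = ∑ g : GL (Fin N) F, if (torus t)⁻¹ * g ∈ uni F (N := N) (· > ·) then f g else 0 := by
    intro t
    rw [sum_subgroup _ (fun l => f (torus t * (l : GL (Fin N) F))),
      ← Equiv.sum_comp (Equiv.mulLeft (torus t))
      (fun g => if (torus t)⁻¹ * g ∈ uni F (N := N) (· > ·) then f g else 0)]
    refine Finset.sum_congr rfl fun g _ => ?_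
    simp only [Equiv.coe_mulLeft, inv_mul_cancel_left]
  simp only [h1]
  rw [Finset.sum_comm]
  refine Finset.sum_congr rfl fun g _ => ?_
  split_ifs with hg
  · obtain ⟨t, ht⟩ := exists_torus_inv_mul_mem g fun i j hij => hg j i hij
    rw [Finset.sum_eq_single t]
    · simp [ht]
    · intro s _ hs
      rw [if_neg]
      intro hmem
      refine hs (torus_mul_uni_injective hmem ht ?_).1
      rw [mul_inv_cancel_left, mul_inv_cancel_left]
    · simp
  · refine (Finset.sum_eq_zero fun t _ => if_neg fun hmem => hg ?_).symm
    intro i j hij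
    have := torus_mul_uni_apply_of_lt t hmem hij
    rwa [mul_inv_cancel_left] at this

lemma conv_traceChar_of_invariant {ψ : AddChar F ℂ} (hψ : ψ ≠ 0) (b : GL (Fin N) F → ℂ)
    (hb : ∀ l : uni F (N := N) (· > ·), ∀ z, b (l * z) = b z) (z : GL (Fin N) F) :
    conv (traceChar ψ) b z = Fintype.card (uni F (N := N) (· > ·))
      * ∑ t, (∏ i, ψ (t i : Fˣ)) * b ((torus t)⁻¹ * z) := by
  rw [conv_traceChar_of_equivariant (fun i j : Fin N => i > j) (Or.inr fun _ _ h => h) hψ 0]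
  · simp only [Matrix.zero_apply, Matrix.trace_zero, sub_zero]
    rw [sum_lower (fun g => ψ g.val.trace * b (g⁻¹ * z)), Finset.mul_sum]
    refine Finset.sum_congr rfl fun t _ => ?_
    rw [← nsmul_eq_mul, ← Finset.card_univ, ← Finset.sum_const]
    refine Finset.sum_congr rfl fun l _ => ?_
    have h1 : (torus t * (l : GL (Fin N) F)).val.trace = ∑ i, (t i : F) :=
      Finset.sum_congr rfl fun i _ => torus_mul_uni_apply_self t l.2 i
    have h2 := hb l⁻¹ ((torus t)⁻¹ * z)
    rw [h1, addChar_map_sum, _root_.mul_inv_rev, mul_assoc (l : GL (Fin N) F)⁻¹]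
    rw [← h2]
    rfl
  · intro u y
    have := hb u⁻¹ y
    simpa using this

lemma eq_one_of_conj_mem_uni (x : GL (Fin N) F) (l : uni F (N := N) (· > ·)) (t : Fin N → Fˣ)
    (h : x * (l * (torus t)⁻¹) * x⁻¹ ∈ uni F (N := N) (· < ·)) : t = 1 := by
  funext i
  set a : F := (((t i)⁻¹ : Fˣ) : F) with ha
  set A : GL (Fin N) F := l * (torus t)⁻¹ with hA
  have hAij : ∀ i j, A i j = (l : GL (Fin N) F) i j * ((t j)⁻¹ : Fˣ) := by
    intro i j
    rw [hA, ← map_inv, mul_torus_apply]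
    rfl
  have h1 : (a • (1 : Matrix (Fin N) (Fin N) F) - A.val).det = 0 := by
    rw [Matrix.det_of_isLowerTriangular]
    · refine Finset.prod_eq_zero (mem_univ i) ?_
      rw [Matrix.sub_apply, hAij, uni_apply_self l.2]
      simp [ha]
    · intro j k hjk
      have hjk' : j < k := hjk
      rw [Matrix.sub_apply, hAij, uni_apply_of_lt l.2 hjk']
      simp [hjk'.ne]
  have h2 : (a • (1 : Matrix (Fin N) (Fin N) F) - (x * A * x⁻¹).val).det = (a - 1) ^ N := by
    rw [Matrix.det_of_isUpperTriangular]
    · have : ∀ j, (a • (1 : Matrix (Fin N) (Fin N) F) - (x * A * x⁻¹).val) j j = a - 1 := by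
        intro j
        rw [Matrix.sub_apply, uni_apply_self h]
        simp
      simp only [this]
      simp
    · intro j k hjk
      have hjk' : k < j := hjk
      rw [Matrix.sub_apply, uni_apply_of_not h (lt_asymm hjk') hjk'.ne']
      simp [hjk'.ne']
  have h3 : a • (1 : Matrix (Fin N) (Fin N) F) - (x * A * x⁻¹).val
      = x.val * (a • (1 : Matrix (Fin N) (Fin N) F) - A.val) * (x⁻¹).val := by
    rw [mul_sub, sub_mul, Matrix.mul_smul, Matrix.smul_mul, mul_one, Units.mul_inv,
      Units.val_mul, Units.val_mul]
  rw [h3, Matrix.det_mul, Matrix.det_mul, h1, mul_zero, zero_mul] at h2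
  have h4 : a = 1 := sub_eq_zero.mp (eq_zero_of_pow_eq_zero h2.symm)
  have h5 : (t i)⁻¹ = 1 := Units.ext h4
  simpa using h5

lemma eq_one_of_mem_uni_of_lower {u : GL (Fin N) F} (hu : u ∈ uni F (N := N) (· < ·))
    (h : ∀ i j, i < j → u i j = 0) : u = 1 := by
  apply Units.ext
  ext i j
  by_cases hij : i < j
  · rw [h i j hij, Units.val_one, Matrix.one_apply_ne hij.ne]
  · exact hu i j hij

/-- The big cell of products of upper unitriangular, diagonal and lower unitriangular matrices. -/
noncomputable def bigCell (F : Type*) [Field F] [Fintype F] (N : ℕ) : Finset (GL (Fin N) F) :=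
  univ.image fun p : uni F (N := N) (· < ·) × (Fin N → Fˣ) × uni F (N := N) (· > ·) =>
    (p.1 : GL (Fin N) F) * (torus p.2.1 * p.2.2)

lemma card_bigCell : (bigCell F N).card = Fintype.card (uni F (N := N) (· < ·))
    * (Fintype.card Fˣ ^ N * Fintype.card (uni F (N := N) (· > ·))) := by
  rw [bigCell, Finset.card_image_of_injective]
  · rw [Finset.card_univ, Fintype.card_prod, Fintype.card_prod, Fintype.card_fun, Fintype.card_fin]
  · rintro ⟨u, t, l⟩ ⟨u', t', l'⟩ h
    simp only at h
    have h1 : (u' : GL (Fin N) F)⁻¹ * u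
        = torus t' * (l' * (l : GL (Fin N) F)⁻¹) * (torus t)⁻¹ := by
      calc (u' : GL (Fin N) F)⁻¹ * u
          = (u' : GL (Fin N) F)⁻¹ * (u * (torus t * l)) * (l : GL (Fin N) F)⁻¹ * (torus t)⁻¹ := by
            group
        _ = _ := by rw [h]; group
    have h2 : (u' : GL (Fin N) F)⁻¹ * u = 1 := by
      refine eq_one_of_mem_uni_of_lower (mul_mem (inv_mem u'.2) u.2) fun i j hij => ?_
      rw [h1, torus_conj_apply, uni_apply_of_lt (mul_mem l'.2 (inv_mem l.2)) hij, mul_zero,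
        zero_mul]
    have h3 : u = u' := Subtype.ext (inv_mul_eq_one.mp h2).symm
    subst h3
    obtain ⟨h4, h5⟩ := torus_mul_uni_injective l.2 l'.2 (mul_left_cancel h)
    rw [h4, Subtype.ext h5]

lemma eq_one_of_mem_bigCell {x : GL (Fin N) F} (hx : x ∈ bigCell F N)
    (m : uni F (N := N) (· > ·)) (h : x * m * x⁻¹ ∈ uni F (N := N) (· < ·)) : m = 1 := by
  obtain ⟨⟨u, t, l⟩, -, rfl⟩ := Finset.mem_image.mp hx
  simp only at h
  set c : GL (Fin N) F := torus t * (l * m * (l : GL (Fin N) F)⁻¹) * (torus t)⁻¹ with hc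
  have h1 : c ∈ uni F (N := N) (· < ·) := by
    have := mul_mem (mul_mem (inv_mem u.2) h) u.2
    convert this using 1
    rw [hc]
    group
  have h2 : c = 1 := by
    refine eq_one_of_mem_uni_of_lower h1 fun i j hij => ?_
    rw [hc, torus_conj_apply, uni_apply_of_lt (mul_mem (mul_mem l.2 m.2) (inv_mem l.2)) hij,
      mul_zero, zero_mul]
  apply Subtype.ext
  have h3 : (m : GL (Fin N) F) = (torus t * l)⁻¹ * c * (torus t * l) := by
    rw [hc]
    group
  rw [h3, h2]
  simp

end Torus
end GaussEquidist

namespace GaussEquidist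
section Bruhat
open scoped Classical ComplexConjugate
open Finset Matrix

variable {F : Type*} [Field F] {N : ℕ}

lemma exists_ne_zero_row (z : GL (Fin N) F) (i : Fin N) : ∃ j, z i j ≠ 0 := by
  by_contra! h
  have hdet : z.val.det ≠ 0 := ((Matrix.isUnit_iff_isUnit_det _).mp z.isUnit).ne_zero
  exact hdet (Matrix.det_eq_zero_of_row_eq_zero i h)

variable [Fintype F]

lemma exists_uni_col (j : Fin N) (c : Fin N → F) : ∃ l ∈ uni F (N := N) (· > ·),
    ∀ (M : Matrix (Fin N) (Fin N) F) a b,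
      (M * (l : GL (Fin N) F).val) a b = M a b + if b < j then M a j * c b else 0 := by
  refine ⟨(uniEquiv (· > ·) (Or.inr fun _ _ h => h)
    fun p => if p.1.1 = j then c p.1.2 else 0).1, Subtype.property _, fun M a b => ?_⟩
  rw [coe_uniEquiv, uniMat, mul_add, mul_one, Matrix.add_apply, Matrix.mul_apply]
  congr 1
  rw [Finset.sum_eq_single j]
  · by_cases h : b < j <;> simp [h]
  · intro k _ hk
    by_cases h : b < k <;> simp [h, hk]
  · simp

lemma exists_uni_row (k : Fin N) (c : Fin N → F) : ∃ l ∈ uni F (N := N) (· > ·),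
    ∀ (M : Matrix (Fin N) (Fin N) F) a b,
      ((l : GL (Fin N) F).val * M) a b = M a b + if k < a then c a * M k b else 0 := by
  refine ⟨(uniEquiv (· > ·) (Or.inr fun _ _ h => h)
    fun p => if p.1.2 = k then c p.1.1 else 0).1, Subtype.property _, fun M a b => ?_⟩
  rw [coe_uniEquiv, uniMat, add_mul, one_mul, Matrix.add_apply, Matrix.mul_apply]
  congr 1
  rw [Finset.sum_eq_single k]
  · by_cases h : k < a <;> simp [h]
  · intro i _ hi
    by_cases h : i < a <;> simp [h, hi]
  · simp

/-- Each of the first `k` rows has at most one nonzero entry, which is alone in its column. -/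
def IsMonomialUpTo (M : Matrix (Fin N) (Fin N) F) (k : ℕ) : Prop :=
  ∀ i : Fin N, i.val < k → ∃ j, (∀ j', j' ≠ j → M i j' = 0) ∧ ∀ i', i' ≠ i → M i' j = 0

lemma isMonomialUpTo_succ (z : GL (Fin N) F) (k : Fin N) (hz : IsMonomialUpTo z.val k) :
    ∃ l ∈ uni F (N := N) (· > ·), ∃ l' ∈ uni F (N := N) (· > ·),
      IsMonomialUpTo (l * z * l' : GL (Fin N) F).val (k + 1) := by
  obtain ⟨j, hj, hmax⟩ := Finset.exists_max_image (univ.filter fun j => z k j ≠ 0) id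
    (by obtain ⟨j, hj⟩ := exists_ne_zero_row z k; exact ⟨j, by simpa using hj⟩)
  simp only [mem_filter, mem_univ, true_and, id] at hj hmax
  have hlast : ∀ b, j < b → z k b = 0 := by
    intro b hb
    by_contra hne
    exact absurd (hmax b hne) (not_le.mpr hb)
  have habove : ∀ i, i < k → z i j = 0 := by
    intro i hi
    obtain ⟨j₀, h1, h2⟩ := hz i hi
    refine h1 j ?_
    rintro rfl
    exact hj (h2 k hi.ne')
  obtain ⟨l', hl', hcol⟩ := exists_uni_col j fun b => -(z k b / z k j)
  obtain ⟨l, hl, hrow⟩ := exists_uni_row k fun a => -(z a j / z k j)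
  refine ⟨l, hl, l', hl', ?_⟩
  set A : Matrix (Fin N) (Fin N) F := z.val * l'.val with hA
  have hAk : ∀ b, b ≠ j → A k b = 0 := by
    intro b hb
    rw [hA, hcol]
    rcases lt_or_gt_of_ne hb with h | h
    · rw [if_pos h]
      field_simp
      ring
    · rw [if_neg (lt_asymm h), hlast b h, add_zero]
  have hAj : ∀ a, A a j = z a j := by
    intro a
    rw [hA, hcol, if_neg (lt_irrefl _), add_zero]
  have hM : ∀ a b, (l * z * l' : GL (Fin N) F).val a b
      = A a b + if k < a then -(z a j / z k j) * A k b else 0 := by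
    intro a b
    rw [Units.val_mul, Units.val_mul, mul_assoc, hrow]
  have hAlow : ∀ i, i < k → ∀ b, A i b = z i b := by
    intro i hi b
    rw [hA, hcol, habove i hi]
    simp
  intro i hi
  rcases (Nat.lt_succ_iff_lt_or_eq.mp hi) with h | h
  · have hik : i < k := h
    obtain ⟨j₀, h1, h2⟩ := hz i hik
    have hkj₀ : z k j₀ = 0 := h2 k hik.ne'
    have hne : j₀ ≠ j := by
      rintro rfl
      exact hj hkj₀
    refine ⟨j₀, fun j' hj' => ?_, fun i' hi' => ?_⟩
    · rw [hM, if_neg (lt_asymm hik), add_zero, hAlow i hik, h1 j' hj']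
    · rw [hM, hAk j₀ hne, mul_zero, ite_self, add_zero, hA, hcol, hkj₀, h2 i' hi']
      simp
  · have hik : i = k := Fin.ext h
    subst hik
    refine ⟨j, fun j' hj' => ?_, fun i' hi' => ?_⟩
    · rw [hM, if_neg (lt_irrefl _), add_zero, hAk j' hj']
    · rw [hM, hAj, hAj]
      rcases lt_or_gt_of_ne hi' with h | h
      · rw [if_neg (lt_asymm h), habove i' h, add_zero]
      · rw [if_pos h]
        field_simp
        ring

lemma exists_isMonomialUpTo (z : GL (Fin N) F) (k : ℕ) (hk : k ≤ N) :
    ∃ l ∈ uni F (N := N) (· > ·), ∃ l' ∈ uni F (N := N) (· > ·),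
      IsMonomialUpTo (l * z * l' : GL (Fin N) F).val k := by
  induction k with
  | zero => exact ⟨1, one_mem _, 1, one_mem _, fun i hi => absurd hi (Nat.not_lt_zero _)⟩
  | succ k ih =>
    obtain ⟨l, hl, l', hl', h⟩ := ih (by omega)
    obtain ⟨m, hm, m', hm', h'⟩ := isMonomialUpTo_succ _ ⟨k, by omega⟩ h
    refine ⟨m * l, mul_mem hm hl, l' * m', mul_mem hl' hm', ?_⟩
    convert h' using 2
    group

/-- The monomial matrix attached to a permutation and to its nonzero entries. -/
noncomputable def monomialMat (σ : Equiv.Perm (Fin N)) (t : Fin N → Fˣ) :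
    Matrix (Fin N) (Fin N) F :=
  Matrix.of fun i j => if j = σ i then (t i : F) else 0

lemma exists_bruhat (z : GL (Fin N) F) : ∃ l l' : uni F (N := N) (· > ·),
    ∃ (σ : Equiv.Perm (Fin N)) (t : Fin N → Fˣ),
      z.val = l.1.val * monomialMat σ t * l'.1.val := by
  obtain ⟨l, hl, l', hl', h⟩ := exists_isMonomialUpTo z N le_rfl
  set M := l * z * l' with hM
  choose σ h1 h2 using fun i : Fin N => h i i.2
  have hne : ∀ i, M i (σ i) ≠ 0 := by
    intro i hi
    obtain ⟨j, hj⟩ := exists_ne_zero_row M i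
    by_cases hjσ : j = σ i
    · exact hj (hjσ ▸ hi)
    · exact hj (h1 i j hjσ)
  have hinj : Function.Injective σ := by
    intro i i' hii
    by_contra hn
    exact hne i (hii ▸ h2 i' i hn)
  refine ⟨⟨l⁻¹, inv_mem hl⟩, ⟨l'⁻¹, inv_mem hl'⟩,
    Equiv.ofBijective σ (Finite.injective_iff_bijective.mp hinj),
    fun i => Units.mk0 _ (hne i), ?_⟩
  have h3 : monomialMat (Equiv.ofBijective σ (Finite.injective_iff_bijective.mp hinj))
      (fun i => Units.mk0 _ (hne i)) = M.val := by
    ext i j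
    by_cases hj : j = σ i
    · simp [monomialMat, hj]
    · simp [monomialMat, hj, h1 i j hj]
  rw [h3, ← Units.val_mul, ← Units.val_mul]
  congr 1
  rw [hM]
  group

lemma card_conj_mem_le : (univ.filter fun p : GL (Fin N) F × uni F (N := N) (· > ·) =>
      p.1 * p.2 * p.1⁻¹ ∈ uni F (N := N) (· > ·)).card
    ≤ N.factorial * Fintype.card Fˣ ^ N * Fintype.card (uni F (N := N) (· > ·)) ^ 2 := by
  choose l₁ l₂ σ t hb using exists_bruhat (F := F) (N := N)
  let L := uni F (N := N) (· > ·)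
  let f : {p : GL (Fin N) F × L // p.1 * p.2 * p.1⁻¹ ∈ L} →
      (Equiv.Perm (Fin N) × (Fin N → Fˣ)) × (L × L) :=
    fun p => ((σ p.1.1, t p.1.1), (⟨p.1.1 * p.1.2 * p.1.1⁻¹, p.2⟩ * l₁ p.1.1,
      l₂ p.1.1 * p.1.2⁻¹))
  have hf : Function.Injective f := by
    have hrec : ∀ p : {p : GL (Fin N) F × L // p.1 * p.2 * p.1⁻¹ ∈ L},
        p.1.1.val = (f p).2.1.1.val * monomialMat (f p).1.1 (f p).1.2 * (f p).2.2.1.val := by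
      rintro ⟨⟨z, l⟩, hp⟩
      change z.val = (z * l.1 * z⁻¹ * (l₁ z).1).val * monomialMat (σ z) (t z)
        * ((l₂ z).1 * l.1⁻¹).val
      have h1 : z = (z * l.1 * z⁻¹) * z * l.1⁻¹ := by group
      calc z.val = ((z * l.1 * z⁻¹) * z * l.1⁻¹).val := by rw [← h1]
        _ = (z * l.1 * z⁻¹).val * ((l₁ z).1.val * monomialMat (σ z) (t z) * (l₂ z).1.val)
            * (l.1⁻¹).val := by rw [← hb z, ← Units.val_mul, ← Units.val_mul]
        _ = _ := by
          rw [Units.val_mul (z * l.1 * z⁻¹), Units.val_mul (l₂ z).1]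
          simp only [mul_assoc]
    rintro ⟨⟨z, l⟩, hp⟩ ⟨⟨z', l'⟩, hp'⟩ h
    have hz : z = z' := by
      apply Units.ext
      rw [hrec ⟨⟨z, l⟩, hp⟩, h, ← hrec ⟨⟨z', l'⟩, hp'⟩]
    subst hz
    have h2 : l₂ z * l⁻¹ = l₂ z * l'⁻¹ := congrArg (fun q => q.2.2) h
    have hl : l = l' := inv_injective (mul_left_cancel h2)
    subst hl
    rfl
  have := Fintype.card_le_of_injective f hf
  rw [Fintype.card_subtype, Fintype.card_prod, Fintype.card_prod, Fintype.card_prod,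
    Fintype.card_perm, Fintype.card_fun, Fintype.card_fin] at this
  calc _ ≤ _ := this
    _ = _ := by rw [pow_two]

end Bruhat
end GaussEquidist

namespace GaussEquidist
section Whittaker
open scoped Classical ComplexConjugate
open Finset Matrix

lemma conv_iterate_const_mul {G : Type*} [Group G] [Fintype G] (Ψ : G → ℂ) (c : ℂ) (φ : G → ℂ)
    (n : ℕ) : (conv Ψ)^[n] (fun z => c * φ z) = fun z => c * (conv Ψ)^[n] φ z := by
  induction n with
  | zero => rfl
  | succ n ih =>
    simp only [Function.iterate_succ_apply', ih]
    funext z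
    simp only [conv, Finset.mul_sum]
    exact Finset.sum_congr rfl fun g _ => by ring

variable {F : Type*} [Field F] {N : ℕ}

/-- The matrix with ones just below the diagonal. -/
def lowerShift (F : Type*) [Field F] (N : ℕ) : Matrix (Fin N) (Fin N) F :=
  Matrix.of fun i j => if i.val = j.val + 1 then 1 else 0

lemma lowerShift_apply (i j : Fin N) :
    lowerShift F N i j = if i.val = j.val + 1 then 1 else 0 := rfl

lemma trace_lowerShift : (lowerShift F N).trace = 0 :=
  Finset.sum_eq_zero fun i _ => by simp [lowerShift_apply]

lemma trace_lowerShift_mul (M : Matrix (Fin N) (Fin N) F) :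
    (lowerShift F N * M).trace = ∑ i, ∑ j, if i.val = j.val + 1 then M j i else 0 := by
  simp [Matrix.trace, Matrix.mul_apply, lowerShift_apply]

variable [Fintype F]

lemma sum_matrix_trace {ψ : AddChar F ℂ} (hψ : ψ ≠ 0) (m : Matrix (Fin N) (Fin N) F) :
    ∑ X : Matrix (Fin N) (Fin N) F, ψ (X * m).trace
      = if m = 0 then (Fintype.card F : ℂ) ^ (N * N) else 0 := by
  let ℓ : Matrix (Fin N) (Fin N) F →+ F :=
    { toFun := fun X => (X * m).trace
      map_zero' := by simp
      map_add' := fun f g => by simp [add_mul] }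
  have h1 : ∀ X : Matrix (Fin N) (Fin N) F, ψ (X * m).trace = (ψ.compAddMonoidHom ℓ) X :=
    fun _ => rfl
  simp only [h1]
  rw [AddChar.sum_eq_ite]
  have h2 : ψ.compAddMonoidHom ℓ = 0 ↔ m = 0 := by
    constructor
    · intro h
      ext j i
      by_contra hne
      obtain ⟨a, ha⟩ := (AddChar.ne_one_iff (ψ := ψ)).mp hψ
      apply ha
      have h3 := DFunLike.congr_fun h (Matrix.single i j (a * (m j i)⁻¹))
      have h4 : ℓ (Matrix.single i j (a * (m j i)⁻¹)) = a := by
        change (Matrix.single i j (a * (m j i)⁻¹) * m).trace = a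
        rw [Matrix.trace_single_mul]
        have hne' : m j i ≠ 0 := hne
        simp [hne']
      rw [AddChar.compAddMonoidHom_apply, h4] at h3
      exact h3
    · rintro rfl
      ext X
      rw [← h1]
      simp
  have h3 : Fintype.card (Matrix (Fin N) (Fin N) F) = Fintype.card F ^ (N * N) := by
    rw [← Nat.card_eq_fintype_card, ← Nat.card_eq_fintype_card (α := F), Matrix]
    simp [pow_mul]
  simp only [h2, h3, Nat.cast_pow]

lemma sum_norm_conv_sq_le {ψ : AddChar F ℂ} (hψ : ψ ≠ 0) (φ : GL (Fin N) F → ℂ) :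
    ∑ x, ‖conv (traceChar ψ) φ x‖ ^ 2 ≤ (Fintype.card F : ℝ) ^ (N * N) * ∑ x, ‖φ x‖ ^ 2 := by
  set f : Matrix (Fin N) (Fin N) F → ℂ := fun X =>
    ∑ g : GL (Fin N) F, ψ (X * (g⁻¹).val).trace * φ g with hf
  have h1 : ∀ x, conv (traceChar ψ) φ x = f x.val := by
    intro x
    rw [conv, hf, ← Equiv.sum_comp ((Equiv.inv _).trans (Equiv.mulLeft x))]
    refine Finset.sum_congr rfl fun g _ => ?_
    simp [traceChar]
  have h2 : ((∑ X, ‖f X‖ ^ 2 : ℝ) : ℂ)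
      = (((Fintype.card F : ℝ) ^ (N * N) * ∑ x, ‖φ x‖ ^ 2 : ℝ) : ℂ) := by
    rw [← ip_self, Complex.ofReal_mul, ← ip_self]
    simp only [ip, hf, map_sum, Finset.sum_mul_sum]
    rw [Finset.sum_comm, Finset.mul_sum]
    refine Finset.sum_congr rfl fun g _ => ?_
    rw [Finset.sum_comm]
    have h3 : ∀ h : GL (Fin N) F, ∑ X : Matrix (Fin N) (Fin N) F,
        ψ (X * (g⁻¹).val).trace * φ g * conj (ψ (X * (h⁻¹).val).trace * φ h)
        = if g = h then (Fintype.card F : ℂ) ^ (N * N) * (φ g * conj (φ g)) else 0 := by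
      intro h
      have h4 : ∀ X : Matrix (Fin N) (Fin N) F,
          ψ (X * (g⁻¹).val).trace * φ g * conj (ψ (X * (h⁻¹).val).trace * φ h)
          = ψ (X * ((g⁻¹).val - (h⁻¹).val)).trace * (φ g * conj (φ h)) := by
        intro X
        rw [map_mul, ← AddChar.map_neg_eq_conj, mul_sub, Matrix.trace_sub, sub_eq_add_neg,
          AddChar.map_add_eq_mul]
        ring
      simp only [h4]
      rw [← Finset.sum_mul, sum_matrix_trace hψ]
      by_cases hgh : g = h
      · simp [hgh]
      · have : (g⁻¹).val - (h⁻¹).val ≠ 0 := by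
          rw [sub_ne_zero]
          exact fun h' => hgh (inv_injective (Units.ext h'))
        rw [if_neg this, if_neg hgh, zero_mul]
    simp only [h3]
    simp
  have h3 : ∑ X, ‖f X‖ ^ 2 = (Fintype.card F : ℝ) ^ (N * N) * ∑ x, ‖φ x‖ ^ 2 := by
    exact_mod_cast h2
  rw [← h3]
  simp only [h1]
  rw [← Finset.sum_image (s := univ) (g := fun x : GL (Fin N) F => x.val)
    (f := fun X => ‖f X‖ ^ 2) (fun x _ y _ h => Units.ext h)]
  exact Finset.sum_le_univ_sum_of_nonneg fun X => by positivity

lemma sum_norm_conv_iterate_sq_le {ψ : AddChar F ℂ} (hψ : ψ ≠ 0) (φ : GL (Fin N) F → ℂ) (n : ℕ) :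
    ∑ x, ‖(conv (traceChar ψ))^[n] φ x‖ ^ 2
      ≤ (Fintype.card F : ℝ) ^ (n * (N * N)) * ∑ x, ‖φ x‖ ^ 2 := by
  induction n with
  | zero => simp
  | succ n ih =>
    rw [Function.iterate_succ_apply']
    refine (sum_norm_conv_sq_le hψ _).trans ?_
    rw [add_mul, one_mul, add_comm, pow_add, mul_assoc]
    gcongr

lemma trace_lowerShift_mul_mul {u v : GL (Fin N) F} (hu : u ∈ uni F (N := N) (· < ·))
    (hv : v ∈ uni F (N := N) (· < ·)) : (lowerShift F N * (u * v).val).trace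
      = (lowerShift F N * u.val).trace + (lowerShift F N * v.val).trace := by
  simp only [trace_lowerShift_mul, ← Finset.sum_add_distrib]
  refine Finset.sum_congr rfl fun i _ => Finset.sum_congr rfl fun j _ => ?_
  split_ifs with hij
  · have hne : j ≠ i := by
      rintro rfl
      omega
    rw [Units.val_mul, Matrix.mul_apply, Finset.sum_eq_add j i hne]
    · rw [uni_apply_self hu, uni_apply_self hv]
      ring
    · rintro k - ⟨hkj, hki⟩
      rcases lt_or_gt_of_ne hkj with h | h
      · rw [uni_apply_of_not hu (lt_asymm h) h.ne', zero_mul]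
      · have : i < k := by
          rw [Fin.lt_def] at h ⊢
          have := Fin.val_ne_of_ne hki
          omega
        rw [uni_apply_of_not hv (lt_asymm this) this.ne', mul_zero]
    · simp
    · simp
  · simp

/-- The nondegenerate character of the upper unitriangular group attached to `ψ`. -/
noncomputable def whittakerChar (ψ : AddChar F ℂ) (N : ℕ) :
    uni F (N := N) (· < ·) →* ℂ where
  toFun u := ψ (lowerShift F N * u.1.val).trace
  map_one' := by simp [trace_lowerShift]
  map_mul' u v := by
    rw [Subgroup.coe_mul, trace_lowerShift_mul_mul u.2 v.2, AddChar.map_add_eq_mul]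

lemma whittakerChar_apply (ψ : AddChar F ℂ) (u : uni F (N := N) (· < ·)) :
    whittakerChar ψ N u = ψ (lowerShift F N * u.1.val).trace := rfl

/-- The iterates of convolution by `ψ ∘ tr`, applied to the Whittaker character. -/
noncomputable def whittakerIter (ψ : AddChar F ℂ) (N k : ℕ) : GL (Fin N) F → ℂ :=
  (conv (traceChar ψ))^[k] (extendZero _ (whittakerChar ψ N))

lemma whittakerIter_succ {ψ : AddChar F ℂ} (hψ : ψ ≠ 0) (k : ℕ) (x : GL (Fin N) F) :
    whittakerIter ψ N (k + 1) x = ∑ h : GL (Fin N) F,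
      if ∀ i j : Fin N, i < j → h j i = lowerShift F N j i then
        ψ h.val.trace * whittakerIter ψ N k (h⁻¹ * x) else 0 := by
  have h1 : ∀ u : uni F (N := N) (· < ·), ∀ y, whittakerIter ψ N k ((u : GL (Fin N) F)⁻¹ * y)
      = ψ (-(lowerShift F N * u.1.val).trace) * whittakerIter ψ N k y := by
    intro u y
    have h2 : (fun z => extendZero _ (whittakerChar ψ N) ((u : GL (Fin N) F)⁻¹ * z))
        = fun z => ψ (-(lowerShift F N * u.1.val).trace)
          * extendZero _ (whittakerChar ψ N) z := by
      funext z
      have h3 := extendZero_mul_left _ (whittakerChar ψ N) u⁻¹ z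
      rw [Subgroup.coe_inv] at h3
      rw [h3]
      congr 1
      have h4 : whittakerChar ψ N u⁻¹ * whittakerChar ψ N u = 1 := by
        rw [← map_mul, inv_mul_cancel, map_one]
      have h5 : ψ (-(lowerShift F N * u.1.val).trace) * whittakerChar ψ N u = 1 := by
        rw [whittakerChar_apply, ← AddChar.map_add_eq_mul, neg_add_cancel, AddChar.map_zero_eq_one]
      have h6 : whittakerChar ψ N u ≠ 0 := right_ne_zero_of_mul_eq_one h4
      exact mul_right_cancel₀ h6 (h4.trans h5.symm)
    have h7 := conv_iterate_translate (traceChar_conj ψ)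
      (extendZero _ (whittakerChar ψ N)) (u : GL (Fin N) F)⁻¹ k
    rw [h2, conv_iterate_const_mul] at h7
    exact (congrFun h7 y).symm
  rw [whittakerIter, Function.iterate_succ_apply']
  have := conv_traceChar_of_equivariant (fun i j : Fin N => i < j) (Or.inl fun _ _ h => h) hψ
    (lowerShift F N) (whittakerIter ψ N k) h1 x
  simp only [trace_lowerShift, sub_zero] at this
  exact this

end Whittaker
end GaussEquidist

namespace GaussEquidist
section WhittakerScaling
open scoped Classical ComplexConjugate
open Finset Matrix

variable {F : Type*} [Field F] {n : ℕ}

/-- The entry of the first column just above row `k`. -/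
noncomputable def firstColAbove (k : ℕ) (x : GL (Fin (n + 1)) F) : F :=
  ∑ i : Fin (n + 1), if i.val + 1 = k then x i 0 else 0

lemma mul_apply_zero_of_lower {h y : GL (Fin (n + 1)) F} (j k : Fin (n + 1))
    (hh : ∀ i < j, h j i = lowerShift F (n + 1) j i)
    (hy : ∀ i : Fin (n + 1), k ≤ i → y i 0 = if i = k then 1 else 0) (hkj : k ≤ j) :
    (h * y) j 0 = h j k + if j = k then firstColAbove k.val y else 0 := by
  have h1 : ∀ i, h j i * y i 0 = (if i = k then h j k else 0)
      + if j = k then (if i.val + 1 = k.val then y i 0 else 0) else 0 := by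
    intro i
    rcases lt_or_ge i k with hik | hik
    · rw [hh i (hik.trans_le hkj), lowerShift_apply, if_neg hik.ne, zero_add]
      rw [Fin.lt_def] at hik
      rw [Fin.le_def] at hkj
      by_cases hjk : j = k
      · subst hjk
        simp [eq_comm]
      · have : j.val ≠ i.val + 1 := fun h' => hjk (Fin.ext (by omega))
        simp [hjk, this]
    · have : i.val + 1 ≠ k.val := by
        rw [Fin.le_def] at hik
        omega
      rw [hy i hik, if_neg this, ite_self, add_zero]
      by_cases hik' : i = k <;> simp [hik']
  rw [Units.val_mul, Matrix.mul_apply, Finset.sum_congr rfl fun i _ => h1 i,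
    Finset.sum_add_distrib, firstColAbove]
  by_cases hjk : j = k <;> simp [hjk]

variable [Fintype F]

lemma apply_zero_of_whittakerIter_ne_zero {ψ : AddChar F ℂ} (hψ : ψ ≠ 0) (k : ℕ)
    (x : GL (Fin (n + 1)) F) (hx : whittakerIter ψ (n + 1) k x ≠ 0) (j : Fin (n + 1))
    (hj : k ≤ j.val) : x j 0 = if j.val = k then 1 else 0 := by
  induction k generalizing x j with
  | zero =>
    have hU : x ∈ uni F (N := n + 1) (· < ·) := by
      by_contra h
      exact hx (extendZero_of_notMem _ _ h)
    rw [hU j 0 (Fin.not_lt_zero j), Matrix.one_apply]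
    simp only [Fin.ext_iff, Fin.val_zero]
  | succ k ih =>
    rw [whittakerIter_succ hψ] at hx
    obtain ⟨h, -, hh⟩ := Finset.exists_ne_zero_of_sum_ne_zero hx
    rw [ne_eq, ite_eq_right_iff, Classical.not_imp] at hh
    obtain ⟨h1, h2⟩ := hh
    have h3 := ih _ (right_ne_zero_of_mul h2)
    have hk : k < n + 1 := by omega
    have h4 := mul_apply_zero_of_lower (h := h) (y := h⁻¹ * x) j ⟨k, hk⟩ (fun i hi => h1 i j hi)
      (fun i hi => by rw [h3 i hi]; simp [Fin.ext_iff]) (by rw [Fin.le_def]; simp; omega)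
    have h5 : ¬ j = ⟨k, hk⟩ := by
      rintro rfl
      simp at hj
    rw [mul_inv_cancel_left, if_neg h5, add_zero, h1 ⟨k, hk⟩ j (by rw [Fin.lt_def]; exact hj),
      lowerShift_apply] at h4
    exact h4

/-- The diagonal matrix with entries `t` in the first `k` places. -/
noncomputable def partialScalar (n k : ℕ) (t : Fˣ) : GL (Fin n) F :=
  torus fun i => if i.val < k then t else 1

lemma whittakerIter_partialScalar {ψ : AddChar F ℂ} (hψ : ψ ≠ 0) (t : Fˣ) (k : ℕ)
    (hk : k ≤ n + 1) (x : GL (Fin (n + 1)) F) :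
    whittakerIter ψ (n + 1) k (partialScalar (n + 1) k t * x)
      = ψ ((t - 1) * firstColAbove k x) * whittakerIter ψ (n + 1) k x := by
  induction k generalizing x with
  | zero =>
    have : partialScalar (n + 1) 0 t = 1 := by simp [partialScalar, ← Pi.one_def]
    simp [this, firstColAbove]
  | succ k ih =>
    have hk' : k < n + 1 := hk
    set D := partialScalar (n + 1) (k + 1) t with hD
    set D' := partialScalar (n + 1) k t with hD'
    rw [whittakerIter_succ hψ, whittakerIter_succ hψ, ← Equiv.sum_comp
      ((Equiv.mulLeft D).trans (Equiv.mulRight D'⁻¹)), Finset.mul_sum]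
    refine Finset.sum_congr rfl fun h _ => ?_
    have hent : ∀ i j, (D * h * D'⁻¹) i j = (if i.val < k + 1 then t else 1 : Fˣ) * h i j
        * (((if j.val < k then t else 1)⁻¹ : Fˣ) : F) := fun i j => torus_conj_apply _ _ _ _ _
    have hcond : (∀ i j : Fin (n + 1), i < j →
        (D * h * D'⁻¹) j i = lowerShift F (n + 1) j i) ↔
        ∀ i j : Fin (n + 1), i < j → h j i = lowerShift F (n + 1) j i := by
      refine forall_congr' fun i => forall_congr' fun j => imp_congr_right fun hij => ?_
      rw [hent, lowerShift_apply]
      by_cases hj : j.val = i.val + 1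
      · simp only [hj, add_lt_add_iff_right, if_true]
        rw [mul_right_comm, Units.mul_inv, one_mul]
      · simp [hj]
    have htr : (D * h * D'⁻¹).val.trace = h.val.trace + (t - 1) * h ⟨k, hk'⟩ ⟨k, hk'⟩ := by
      have : ∀ i, (D * h * D'⁻¹) i i = h i i
          + if i = ⟨k, hk'⟩ then (t - 1 : F) * h ⟨k, hk'⟩ ⟨k, hk'⟩ else 0 := by
        intro i
        rw [hent]
        rcases lt_trichotomy i.val k with hi | hi | hi
        · have : i ≠ ⟨k, hk'⟩ := by rintro rfl; simp at hi
          rw [if_pos (by omega), if_pos hi, mul_right_comm, Units.mul_inv]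
          simp [this]
        · have : i = ⟨k, hk'⟩ := Fin.ext hi
          subst this
          simp
          ring
        · have : i ≠ ⟨k, hk'⟩ := by rintro rfl; simp at hi
          rw [if_neg (by omega), if_neg (by omega)]
          simp [this]
      unfold Matrix.trace
      simp only [Matrix.diag_apply, this, Finset.sum_add_distrib]
      simp
    simp only [Equiv.trans_apply, Equiv.coe_mulLeft, Equiv.coe_mulRight, hcond, htr]
    split_ifs with hh
    · have h1 : (D * h * D'⁻¹)⁻¹ * (D * x) = D' * (h⁻¹ * x) := by group
      rw [h1, ih hk'.le]
      by_cases hW : whittakerIter ψ (n + 1) k (h⁻¹ * x) = 0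
      · simp [hW]
      · have h2 := apply_zero_of_whittakerIter_ne_zero hψ k _ hW
        have h3 := mul_apply_zero_of_lower (h := h) (y := h⁻¹ * x) ⟨k, hk'⟩ ⟨k, hk'⟩
          (fun i hi => hh i _ hi) (fun i hi => by rw [h2 i hi]; simp [Fin.ext_iff]) le_rfl
        rw [mul_inv_cancel_left, if_pos rfl] at h3
        have h4 : firstColAbove (k + 1) x = x ⟨k, hk'⟩ 0 := by
          rw [firstColAbove, Finset.sum_eq_single ⟨k, hk'⟩]
          · simp
          · intro i _ hi
            rw [if_neg]
            intro h'
            exact hi (Fin.ext (by simpa using h'))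
          · simp
        rw [h4, h3, AddChar.map_add_eq_mul, mul_add, AddChar.map_add_eq_mul]
        ring
    · simp

end WhittakerScaling
end GaussEquidist

namespace GaussEquidist
section WhittakerMass
open scoped Classical ComplexConjugate
open Finset Matrix

variable {F : Type*} [Field F] {n : ℕ}

lemma det_partialScalar (t : Fˣ) :
    Matrix.GeneralLinearGroup.det (partialScalar (n + 1) n t) = t ^ n := by
  apply Units.ext
  rw [Matrix.GeneralLinearGroup.val_det_apply, partialScalar, coe_torus, Matrix.det_diagonal,
    Fin.prod_univ_castSucc]
  simp

variable [Fintype F]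

lemma card_pow_eq_le (hn : 0 < n) (c : Fˣ) : #{t : Fˣ | t ^ n = c} ≤ n :=
  (card_nthRoots_subgroup_units (Units.coeHom F) Units.val_injective hn c).trans
    (Polynomial.card_nthRoots n _)

lemma sum_norm_whittakerIter_det_one_le {ψ : AddChar F ℂ} (hψ : ψ ≠ 0) (hn : 0 < n) :
    (Fintype.card Fˣ : ℝ) * (∑ x : GL (Fin (n + 1)) F,
      if Matrix.GeneralLinearGroup.det x = 1 then ‖whittakerIter ψ (n + 1) n x‖ ^ 2 else 0)
    ≤ n * ((Fintype.card F : ℝ) ^ (n * ((n + 1) * (n + 1)))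
      * Fintype.card (uni F (N := n + 1) (· < ·))) := by
  have h1 : ∀ t : Fˣ, (∑ x : GL (Fin (n + 1)) F,
      if Matrix.GeneralLinearGroup.det x = 1 then ‖whittakerIter ψ (n + 1) n x‖ ^ 2 else 0)
      = ∑ x : GL (Fin (n + 1)) F, if t ^ n = Matrix.GeneralLinearGroup.det x then
        ‖whittakerIter ψ (n + 1) n x‖ ^ 2 else 0 := by
    intro t
    rw [← Equiv.sum_comp (Equiv.mulLeft (partialScalar (n + 1) n t))
      (fun x => if t ^ n = Matrix.GeneralLinearGroup.det x then
        ‖whittakerIter ψ (n + 1) n x‖ ^ 2 else 0)]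
    refine Finset.sum_congr rfl fun x _ => ?_
    rw [Equiv.coe_mulLeft, whittakerIter_partialScalar hψ t n n.le_succ, norm_mul,
      AddChar.norm_apply, one_mul, map_mul, det_partialScalar]
    simp [eq_comm]
  have h2 : ∑ x, ‖extendZero _ (whittakerChar ψ (n + 1)) x‖ ^ 2
      = (Fintype.card (uni F (N := n + 1) (· < ·)) : ℝ) := by
    have h3 : ∀ x, ‖extendZero _ (whittakerChar ψ (n + 1)) x‖ ^ 2
        = if x ∈ uni F (N := n + 1) (· < ·) then (1 : ℝ) else 0 := by
      intro x
      split_ifs with hx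
      · rw [show x = ((⟨x, hx⟩ : uni F (N := n + 1) (· < ·)) : GL (Fin (n + 1)) F) from rfl,
          extendZero_coe, norm_hom, one_pow]
      · rw [extendZero_of_notMem _ _ hx]
        simp
    rw [Finset.sum_congr rfl fun x _ => h3 x, Finset.sum_boole, Fintype.card_subtype]
  calc _ = ∑ t : Fˣ, ∑ x : GL (Fin (n + 1)) F, if t ^ n = Matrix.GeneralLinearGroup.det x then
        ‖whittakerIter ψ (n + 1) n x‖ ^ 2 else 0 := by
        rw [← nsmul_eq_mul, ← Finset.card_univ, ← Finset.sum_const]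
        exact Finset.sum_congr rfl fun t _ => h1 t
    _ = ∑ x : GL (Fin (n + 1)) F, (#{t : Fˣ | t ^ n = Matrix.GeneralLinearGroup.det x} : ℝ)
        * ‖whittakerIter ψ (n + 1) n x‖ ^ 2 := by
        rw [Finset.sum_comm]
        refine Finset.sum_congr rfl fun x _ => ?_
        rw [← Finset.sum_filter, Finset.sum_const, nsmul_eq_mul]
    _ ≤ ∑ x : GL (Fin (n + 1)) F, (n : ℝ) * ‖whittakerIter ψ (n + 1) n x‖ ^ 2 := by
        gcongr
        exact card_pow_eq_le hn _
    _ ≤ _ := by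
        rw [← Finset.mul_sum, ← h2]
        gcongr
        exact sum_norm_conv_iterate_sq_le hψ _ n

end WhittakerMass
end GaussEquidist

namespace GaussEquidist
section LowerMirabolic
open scoped Classical ComplexConjugate
open Finset Matrix

variable {F : Type*} [Field F] {n : ℕ}

/-- Invertible lower triangular matrices whose last row is that of the identity, as a monoid. -/
def lowerMirabolicMonoid (F : Type*) [Field F] (n : ℕ) : Submonoid (GL (Fin (n + 1)) F) where
  carrier := {g | (∀ i j, i < j → g i j = 0) ∧
    ∀ j, g (Fin.last n) j = (1 : Matrix (Fin (n + 1)) (Fin (n + 1)) F) (Fin.last n) j}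
  one_mem' := ⟨fun i j hij => Matrix.one_apply_ne hij.ne, fun _ => rfl⟩
  mul_mem' := by
    rintro g h ⟨hg, hg'⟩ ⟨hh, hh'⟩
    refine ⟨fun i j hij => ?_, fun j => ?_⟩
    · rw [Units.val_mul, Matrix.mul_apply]
      refine Finset.sum_eq_zero fun k _ => ?_
      rcases lt_or_ge i k with hik | hik
      · rw [hg i k hik, zero_mul]
      · rw [hh k j (hik.trans_lt hij), mul_zero]
    · rw [Units.val_mul, Matrix.mul_apply]
      simp only [hg', Matrix.one_apply, ite_mul, one_mul, zero_mul, Finset.sum_ite_eq, mem_univ,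
        if_true, hh']

/-- Invertible lower triangular matrices whose last row is that of the identity. -/
def lowerMirabolic (F : Type*) [Field F] [Finite F] (n : ℕ) : Subgroup (GL (Fin (n + 1)) F) where
  __ := lowerMirabolicMonoid F n
  inv_mem' := by
    intro g hg
    have : g⁻¹ = g ^ (Nat.card (GL (Fin (n + 1)) F) - 1) := by
      refine inv_eq_of_mul_eq_one_right ?_
      rw [← pow_succ', Nat.sub_add_cancel Nat.card_pos, pow_card_eq_one']
    rw [this]
    exact pow_mem (S := lowerMirabolicMonoid F n) hg _

variable [Fintype F]

lemma exists_uni_column (k : Fin (n + 1)) (w : Fin (n + 1) → F) (hw : ∀ i, k ≤ i → w i = 0) :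
    ∃ u : uni F (N := n + 1) (· < ·), (u : GL (Fin (n + 1)) F).val
      = 1 + Matrix.vecMulVec w (Pi.single k 1) := by
  refine ⟨uniEquiv (fun i j : Fin (n + 1) => i < j) (Or.inl fun _ _ h => h)
    fun p => if p.1.2 = k then w p.1.1 else 0, ?_⟩
  rw [coe_uniEquiv, uniMat]
  congr 1
  ext i j
  rw [Matrix.of_apply, Matrix.vecMulVec_apply, Pi.single_apply]
  by_cases hj : j = k
  · subst hj
    by_cases hij : i < j
    · simp [hij]
    · simp [hij, hw i (not_lt.mp hij)]
  · simp [hj]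

lemma whittakerChar_column (ψ : AddChar F ℂ) (k : Fin n) (w : Fin (n + 1) → F)
    (u : uni F (N := n + 1) (· < ·))
    (hu : (u : GL (Fin (n + 1)) F).val = 1 + Matrix.vecMulVec w (Pi.single k.succ 1)) :
    whittakerChar ψ (n + 1) u = ψ (w k.castSucc) := by
  rw [whittakerChar_apply, hu, mul_add, mul_one, Matrix.trace_add, trace_lowerShift, zero_add,
    Matrix.mul_vecMulVec, Matrix.trace_vecMulVec, dotProduct_single_one, Matrix.mulVec,
    dotProduct, Finset.sum_eq_single k.castSucc]
  · simp [lowerShift_apply]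
  · intro i _ hi
    rw [lowerShift_apply, if_neg, zero_mul]
    intro h
    exact hi (Fin.ext (by simpa using h.symm))
  · simp

lemma exists_conj_whittakerChar_ne {ψ : AddChar F ℂ} (hψ : ψ ≠ 0) {p p' : GL (Fin (n + 1)) F}
    (hp : p ∈ lowerMirabolic F n) (hp' : p' ∈ lowerMirabolic F n) (hne : p ≠ p') :
    ∃ u u' : uni F (N := n + 1) (· < ·), p * u * p⁻¹ = p' * u' * p'⁻¹ ∧
      whittakerChar ψ (n + 1) u ≠ whittakerChar ψ (n + 1) u' := by
  obtain ⟨s, hs⟩ : ∃ s, s = p'⁻¹ * p := ⟨_, rfl⟩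
  have hmem : s ∈ lowerMirabolic F n := hs ▸ mul_mem (inv_mem hp') hp
  obtain ⟨hlow, hlast⟩ := hmem
  have hs1 : s.val ≠ 1 := by
    intro h
    have h' : s = 1 := Units.ext h
    rw [hs] at h'
    exact hne (inv_mul_eq_one.mp h').symm
  obtain ⟨m, hm, hmax⟩ : ∃ m, (∃ j, s m j ≠ (1 : Matrix (Fin (n + 1)) (Fin (n + 1)) F) m j) ∧
      ∀ i, m < i → ∀ j, s i j = (1 : Matrix (Fin (n + 1)) (Fin (n + 1)) F) i j := by
    have hS : (univ.filter fun m : Fin (n + 1) =>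
        ∃ j, s m j ≠ (1 : Matrix (Fin (n + 1)) (Fin (n + 1)) F) m j).Nonempty := by
      by_contra hS
      rw [Finset.not_nonempty_iff_eq_empty, Finset.filter_eq_empty_iff] at hS
      refine hs1 (Matrix.ext fun i j => ?_)
      by_contra h
      exact hS (mem_univ i) ⟨j, h⟩
    refine ⟨_, (Finset.mem_filter.mp (Finset.max'_mem _ hS)).2, fun i hi j => ?_⟩
    by_contra h
    exact absurd (Finset.le_max' _ i (Finset.mem_filter.mpr ⟨mem_univ i, j, h⟩)) (not_le.mpr hi)
  obtain ⟨j, hj⟩ := hm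
  have hml : m ≠ Fin.last n := by
    rintro rfl
    exact hj (hlast j)
  obtain ⟨k, rfl⟩ := Fin.exists_castSucc_eq.mpr hml
  have hjk : j ≤ k.castSucc := by
    by_contra h
    rw [not_le] at h
    exact hj (by rw [hlow _ _ h, Matrix.one_apply_ne h.ne])
  have hkk : k.castSucc < k.succ := Fin.castSucc_lt_succ
  obtain ⟨b, hb⟩ := (AddChar.ne_one_iff (ψ := ψ)).mp hψ
  set a : F := b * (s k.castSucc j - (1 : Matrix (Fin (n + 1)) (Fin (n + 1)) F) k.castSucc j)⁻¹
    with ha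
  set v : Fin (n + 1) → F := Pi.single j a with hv
  have hv0 : ∀ i, k.succ ≤ i → v i = 0 := fun i hi =>
    Pi.single_eq_of_ne (by rintro rfl; exact absurd (hi.trans hjk) (not_le.mpr hkk)) _
  have hsv : ∀ i, (s.val *ᵥ v) i = s i j * a := fun i => by
    rw [hv, Matrix.mulVec_single]
    simp
  have hw0 : ∀ i, k.succ ≤ i → (s.val *ᵥ v) i = 0 := fun i hi => by
    rw [hsv, hmax i (hkk.trans_le hi), Matrix.one_apply_ne, zero_mul]
    rintro rfl
    exact absurd (hi.trans hjk) (not_le.mpr hkk)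
  obtain ⟨u, hu⟩ := exists_uni_column k.succ v hv0
  obtain ⟨u', hu'⟩ := exists_uni_column k.succ (s.val *ᵥ v) hw0
  have hrow : Matrix.vecMul (Pi.single k.succ 1) s.val = Pi.single k.succ 1 := by
    funext i
    rw [Matrix.single_one_vecMul, Matrix.row_apply, hmax _ hkk, Matrix.one_apply, Pi.single_apply]
    simp [eq_comm]
  have hcomm : s * u = u' * s := by
    apply Units.ext
    rw [Units.val_mul, Units.val_mul, hu, hu', mul_add, add_mul, mul_one, one_mul,
      Matrix.mul_vecMulVec, Matrix.vecMulVec_mul, hrow]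
  refine ⟨u, u', ?_, ?_⟩
  · have hp : p = p' * s := by rw [hs, mul_inv_cancel_left]
    rw [hp, mul_assoc p' s, hcomm]
    group
  · rw [whittakerChar_column ψ k _ u hu, whittakerChar_column ψ k _ u' hu', hsv]
    intro h
    apply hb
    have h1 : b = s k.castSucc j * a - v k.castSucc := by
      have h2 : v k.castSucc = (1 : Matrix (Fin (n + 1)) (Fin (n + 1)) F) k.castSucc j * a := by
        rw [hv, Pi.single_apply, Matrix.one_apply, ite_mul, one_mul, zero_mul]
      rw [h2, ← sub_mul, ha, mul_left_comm, mul_inv_cancel₀ (sub_ne_zero.mpr hj), mul_one]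
    have h3 : ψ (v k.castSucc) ≠ 0 := fun h0 => by
      have := AddChar.norm_apply ψ (v k.castSucc)
      simp [h0] at this
    have h4 : ψ b * ψ (v k.castSucc) = ψ (v k.castSucc) := by
      rw [← AddChar.map_add_eq_mul, h1, sub_add_cancel, ← h]
    exact mul_right_cancel₀ h3 (h4.trans (one_mul _).symm)

lemma card_lowerMirabolic_ge :
    Fintype.card Fˣ ^ n * Fintype.card (uni F (N := n + 1) (· > ·))
      ≤ #{p : GL (Fin (n + 1)) F | p ∈ lowerMirabolic F n} * Fintype.card F ^ n := by
  let r : Fin (n + 1) → Fin (n + 1) → Prop := fun i j => j < i ∧ i ≠ Fin.last n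
  have : IsStrictOrder (Fin (n + 1)) r :=
    { irrefl := fun i h => lt_irrefl _ h.1
      trans := fun i j k h h' => ⟨h'.1.trans h.1, h.2⟩ }
  have hle : ∀ l ∈ uni F r, l ∈ uni F (N := n + 1) (· > ·) := fun l hl i j hij =>
    hl i j fun h => hij h.1
  have h1 : Fintype.card (uni F (N := n + 1) (· > ·))
      ≤ Fintype.card (uni F r) * Fintype.card F ^ n := by
    rw [card_uni _ (Or.inr fun _ _ h => h), card_uni r (Or.inr fun _ _ h => h.1), ← pow_add]
    refine Nat.pow_le_pow_right Fintype.card_pos ?_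
    calc _ ≤ #((univ.filter fun p : Fin (n + 1) × Fin (n + 1) => r p.1 p.2)
          ∪ univ.image fun j : Fin n => (Fin.last n, j.castSucc)) := by
          refine Finset.card_le_card fun p hp => ?_
          have hp2 : p.2 < p.1 := by simpa using hp
          rw [Finset.mem_union, Finset.mem_filter, Finset.mem_image]
          by_cases h : p.1 = Fin.last n
          · right
            have h2 : p.2 ≠ Fin.last n := fun h2 => lt_irrefl _ (h ▸ h2 ▸ hp2)
            obtain ⟨j, hj⟩ := Fin.exists_castSucc_eq.mpr h2
            exact ⟨j, mem_univ _, Prod.ext h.symm hj⟩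
          · exact Or.inl ⟨mem_univ _, hp2, h⟩
      _ ≤ _ := (Finset.card_union_le _ _).trans (by
          gcongr
          exact Finset.card_image_le.trans (by simp))
  have h2 : Fintype.card Fˣ ^ n * Fintype.card (uni F r)
      ≤ #{p : GL (Fin (n + 1)) F | p ∈ lowerMirabolic F n} := by
    let e : (Fin n → Fˣ) × uni F r → GL (Fin (n + 1)) F := fun z =>
      torus (Fin.snoc z.1 1 : Fin (n + 1) → Fˣ) * (z.2 : GL (Fin (n + 1)) F)
    have he : Function.Injective e := by
      rintro ⟨t, l⟩ ⟨t', l'⟩ h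
      obtain ⟨h3, h4⟩ := torus_mul_uni_injective (hle _ l.2) (hle _ l'.2) h
      have h5 : t = t' := by
        funext i
        simpa using congrFun h3 i.castSucc
      rw [h5, Subtype.ext h4]
    have hmem : ∀ z, e z ∈ lowerMirabolic F n := by
      rintro ⟨t, l⟩
      refine ⟨fun i j hij => torus_mul_uni_apply_of_lt _ (hle _ l.2) hij, fun j => ?_⟩
      rw [torus_mul_apply, l.2 _ _ fun h => h.2 rfl]
      simp
    calc _ = #(univ.image e) := by
          rw [Finset.card_image_of_injective _ he, Finset.card_univ, Fintype.card_prod,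
            Fintype.card_fun, Fintype.card_fin]
      _ ≤ _ := Finset.card_le_card fun p hp => by
          obtain ⟨z, -, rfl⟩ := Finset.mem_image.mp hp
          exact Finset.mem_filter.mpr ⟨mem_univ _, hmem z⟩
  calc _ ≤ Fintype.card Fˣ ^ n * (Fintype.card (uni F r) * Fintype.card F ^ n) := by gcongr
    _ ≤ _ := by
      rw [← mul_assoc]
      gcongr

lemma sum_norm_rightAvg_conjCount_le {ψ : AddChar F ℂ} (hψ : ψ ≠ 0) :
    (#{p : GL (Fin (n + 1)) F | p ∈ lowerMirabolic F n} : ℝ) *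
      ∑ y, ‖rightAvg _ (whittakerChar ψ (n + 1)) 1 (conjCount (uni F (N := n + 1) (· > ·))) y‖ ^ 2
    ≤ (Fintype.card (uni F (N := n + 1) (· < ·)) : ℝ) ^ 2 *
      (Fintype.card (GL (Fin (n + 1)) F) * ((n + 1).factorial * Fintype.card Fˣ ^ (n + 1)
        * Fintype.card (uni F (N := n + 1) (· > ·)) ^ 2)) := by
  have h1 := sum_rightAvg_le _ (whittakerChar ψ (n + 1))
    {p : GL (Fin (n + 1)) F | p ∈ lowerMirabolic F n}
    (conjCount (uni F (N := n + 1) (· > ·))) (fun p hp p' hp' hne =>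
      exists_conj_whittakerChar_ne hψ (Finset.mem_filter.mp hp).2 (Finset.mem_filter.mp hp').2 hne)
  refine le_trans (le_of_eq ?_) (h1.trans ?_)
  · rw [← nsmul_eq_mul, ← Finset.sum_const]
    refine Finset.sum_congr rfl fun p _ => ?_
    simp only [rightAvg_conjCount _ _ _ p]
    rw [← Equiv.sum_comp (MulAut.conj p⁻¹).toEquiv]
    simp
  · rw [sum_norm_conjCount_sq]
    gcongr
    exact_mod_cast card_conj_mem_le

end LowerMirabolic
end GaussEquidist

namespace GaussEquidist
section Kloosterman
open scoped Classical ComplexConjugate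
open Finset Matrix

/-- The multiplicative convolution powers of the restriction of `ψ` to the units. -/
noncomputable def kloosterman {F : Type*} [Field F] [Fintype F] (ψ : AddChar F ℂ) (n : ℕ) :
    Fˣ → ℂ :=
  (conv fun s : Fˣ => ψ s)^[n] (Pi.single 1 1)

lemma conv_iterate_prod {ι T : Type*} [Fintype ι] [Group T] [Fintype T] (w : T → ℂ) (n : ℕ) :
    (conv fun t : ι → T => ∏ i, w (t i))^[n] (Pi.single 1 1)
      = fun t => ∏ i, (conv w)^[n] (Pi.single 1 1) (t i) := by
  induction n with
  | zero =>
    funext t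
    simp only [Function.iterate_zero, id_eq, Pi.single_apply]
    rw [Finset.prod_ite_zero]
    simp [funext_iff]
  | succ n ih =>
    rw [Function.iterate_succ_apply', ih]
    funext t
    simp only [Function.iterate_succ_apply', conv]
    rw [Finset.prod_univ_sum, Fintype.piFinset_univ]
    refine Finset.sum_congr rfl fun g _ => ?_
    rw [Finset.prod_mul_distrib]
    rfl

lemma card_lt_pairs (N : ℕ) :
    #{p : Fin N × Fin N | p.1 < p.2} = #{p : Fin N × Fin N | p.1 > p.2} :=
  Finset.card_equiv (Equiv.prodComm _ _) (by simp)

lemma two_mul_card_gt_pairs (N : ℕ) : 2 * #{p : Fin N × Fin N | p.1 > p.2} + N = N * N := by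
  have h1 : #{p : Fin N × Fin N | p.1 = p.2} = N := by
    have : ({p : Fin N × Fin N | p.1 = p.2} : Finset _) = univ.image fun i => (i, i) := by
      ext ⟨i, j⟩
      simp [eq_comm]
    rw [this, Finset.card_image_of_injective _ fun i j h => (Prod.ext_iff.mp h).1]
    simp
  have h2 : ∀ p : Fin N × Fin N, (1 : ℕ) = (if p.1 < p.2 then 1 else 0)
      + (if p.1 > p.2 then 1 else 0) + if p.1 = p.2 then 1 else 0 := by
    intro p
    rcases lt_trichotomy p.1 p.2 with h | h | h
    · simp [h, h.ne, not_lt.mpr h.le]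
    · simp [h]
    · simp [h, h.ne', not_lt.mpr h.le]
  have h3 : N * N = ∑ p : Fin N × Fin N, 1 := by simp
  rw [h3, Finset.sum_congr rfl fun p _ => h2 p, Finset.sum_add_distrib, Finset.sum_add_distrib]
  simp only [Finset.sum_boole, Nat.cast_id]
  rw [h1, card_lt_pairs]
  ring

variable {F : Type*} [Field F] [Fintype F] {N n : ℕ}

lemma card_uni_gt : Fintype.card (uni F (N := N) (· > ·))
    = Fintype.card F ^ #{p : Fin N × Fin N | p.1 > p.2} := by
  rw [card_uni _ (Or.inr fun _ _ h => h)]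
  congr

lemma card_uni_lt : Fintype.card (uni F (N := N) (· < ·))
    = Fintype.card (uni F (N := N) (· > ·)) := by
  rw [card_uni_gt, card_uni _ (Or.inl fun _ _ h => h), ← card_lt_pairs]
  congr

lemma card_GL_le : Fintype.card (GL (Fin N) F) ≤ Fintype.card F ^ (N * N) := by
  have h3 : Fintype.card (Matrix (Fin N) (Fin N) F) = Fintype.card F ^ (N * N) := by
    rw [← Nat.card_eq_fintype_card, ← Nat.card_eq_fintype_card (α := F), Matrix]
    simp [pow_mul]
  rw [← h3]
  exact Fintype.card_le_of_injective (fun x => x.val) Units.val_injective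

lemma det_of_mem_uni {u : GL (Fin N) F} (hu : u ∈ uni F (N := N) (· < ·)) :
    Matrix.GeneralLinearGroup.det u = 1 := by
  obtain ⟨f, hf⟩ := (uniEquiv _ (Or.inl fun _ _ h => h)).surjective ⟨u, hu⟩
  apply Units.ext
  rw [Matrix.GeneralLinearGroup.val_det_apply, Units.val_one]
  have : u.val = uniMat (fun i j : Fin N => i < j) f := by
    rw [← coe_uniEquiv _ (Or.inl fun _ _ h => h), hf]
  rw [this, det_uniMat _ (Or.inl fun _ _ h => h)]

lemma det_of_mem_uni_gt {u : GL (Fin N) F} (hu : u ∈ uni F (N := N) (· > ·)) :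
    Matrix.GeneralLinearGroup.det u = 1 := by
  obtain ⟨f, hf⟩ := (uniEquiv _ (Or.inr fun _ _ h => h)).surjective ⟨u, hu⟩
  apply Units.ext
  rw [Matrix.GeneralLinearGroup.val_det_apply, Units.val_one]
  have : u.val = uniMat (fun i j : Fin N => i > j) f := by
    rw [← coe_uniEquiv _ (Or.inr fun _ _ h => h), hf]
  rw [this, det_uniMat _ (Or.inr fun _ _ h => h)]

lemma rightAvg_conjCount_eq_zero (η : uni F (N := N) (· < ·) →* ℂ) (y : GL (Fin N) F)
    (hy : Matrix.GeneralLinearGroup.det y ≠ 1) :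
    rightAvg _ η 1 (conjCount (uni F (N := N) (· > ·))) y = 0 := by
  rw [rightAvg_conjCount_eq]
  refine Finset.sum_eq_zero fun x _ => Finset.sum_eq_zero fun l _ => ?_
  refine extendZero_of_notMem _ _ fun h => hy ?_
  have h1 := det_of_mem_uni h
  have h2 := det_of_mem_uni_gt (inv_mem l.2)
  rw [map_mul, map_mul, map_mul, h2, mul_one, map_inv, mul_inv_cancel, one_mul] at h1
  exact h1

lemma norm_ip_whittakerIter_ge {ψ : AddChar F ℂ} (hψ : ψ ≠ 0) :
    (Fintype.card (uni F (N := N) (· > ·)) : ℝ) ^ n * ‖kloosterman ψ n 1‖ ^ N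
      * (Fintype.card (uni F (N := N) (· > ·)) * (Fintype.card (uni F (N := N) (· > ·)) *
        (Fintype.card Fˣ ^ N * Fintype.card (uni F (N := N) (· > ·)))))
    ≤ ‖ip (whittakerIter ψ N n)
      (rightAvg _ (whittakerChar ψ N) 1 (conjCount (uni F (N := N) (· > ·))))‖ := by
  have h0 := ip_conv_conjCount (uni F (N := N) (· < ·)) (uni F (N := N) (· > ·))
    (whittakerChar ψ N) torus (fun t => ∏ i, ψ (t i : Fˣ))
    (traceChar_conj ψ) (conv_traceChar_of_invariant hψ) eq_one_of_conj_mem_uni n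
  have h2 := congrFun (conv_iterate_prod (ι := Fin N) (fun s : Fˣ => ψ s) n) 1
  have h3 : (conv fun t : Fin N → Fˣ => ∏ i, ψ (t i : Fˣ))^[n] (Pi.single 1 1) 1
      = kloosterman ψ n 1 ^ N := by
    refine Eq.trans ?_ (h2.trans ?_)
    · congr!
    · simp only [Pi.one_apply, Finset.prod_const, Finset.card_univ, Fintype.card_fin, kloosterman]
      congr!
  rw [whittakerIter, h0]
  have h1 := card_le_norm_sum_extendZero _ (uni F (N := N) (· > ·)) (whittakerChar ψ N)
    (bigCell F N) fun x hx l h => eq_one_of_mem_bigCell hx l h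
  rw [card_bigCell, card_uni_lt] at h1
  rw [card_uni_lt, norm_mul, norm_mul, norm_mul, norm_pow, Complex.norm_natCast]
  replace h3 := congrArg norm h3
  rw [norm_pow] at h3
  rw [← h3]
  gcongr
  · exact le_of_eq (by congr!)
  · exact_mod_cast h1

lemma norm_ip_whittakerIter_sq_le (ψ : AddChar F ℂ) :
    ‖ip (whittakerIter ψ N n)
      (rightAvg _ (whittakerChar ψ N) 1 (conjCount (uni F (N := N) (· > ·))))‖ ^ 2
    ≤ (∑ x : GL (Fin N) F,
      if Matrix.GeneralLinearGroup.det x = 1 then ‖whittakerIter ψ N n x‖ ^ 2 else 0) *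
      ∑ y, ‖rightAvg _ (whittakerChar ψ N) 1 (conjCount (uni F (N := N) (· > ·))) y‖ ^ 2 := by
  have h1 : ip (whittakerIter ψ N n)
      (rightAvg _ (whittakerChar ψ N) 1 (conjCount (uni F (N := N) (· > ·))))
      = ip (fun x => if Matrix.GeneralLinearGroup.det x = 1 then whittakerIter ψ N n x else 0)
      (rightAvg _ (whittakerChar ψ N) 1 (conjCount (uni F (N := N) (· > ·)))) := by
    refine Finset.sum_congr rfl fun y _ => ?_
    dsimp only
    split_ifs with hy
    · rfl
    · rw [rightAvg_conjCount_eq_zero _ y hy]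
      simp
  rw [h1]
  refine (norm_ip_sq_le _ _).trans (le_of_eq ?_)
  congr 1
  refine Finset.sum_congr rfl fun y _ => ?_
  split_ifs <;> simp

lemma pow_mul_pow_le_of_chain {m f l q c P G M R S K : ℝ} (hm : 0 ≤ m) (hf : 0 ≤ f) (hl : 0 < l)
    (hc : 0 < c) (hq : 0 ≤ q) (hP : 0 ≤ P) (hK : 0 ≤ K) (hM : 0 ≤ M) (hR : 0 ≤ R)
    (h1 : l ^ n * K ^ (n + 1) * (l * (l * (c ^ (n + 1) * l))) ≤ S) (h2 : S ^ 2 ≤ M * R)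
    (h3 : c * M ≤ m * (q ^ (n * ((n + 1) * (n + 1))) * l))
    (h4 : P * R ≤ l ^ 2 * (G * (f * c ^ (n + 1) * l ^ 2)))
    (h5 : c ^ n * l ≤ P * q ^ n) (h6 : G ≤ q ^ ((n + 1) * (n + 1)))
    (h7 : l ^ 2 * q ^ (n + 1) = q ^ ((n + 1) * (n + 1))) :
    c ^ (2 * (n + 1)) * K ^ (2 * (n + 1)) ≤ m * f * q ^ ((n + 1) * (n + 1) + n) := by
  have h8 : (l ^ n * K ^ (n + 1) * (l * (l * (c ^ (n + 1) * l)))) ^ 2 ≤ M * R :=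
    (pow_le_pow_left₀ (by positivity) h1 2).trans h2
  have h9 : (l ^ n * K ^ (n + 1) * (l * (l * (c ^ (n + 1) * l)))) ^ 2 * (c * (c ^ n * l))
      ≤ (m * (q ^ (n * ((n + 1) * (n + 1))) * l)) *
        (l ^ 2 * (q ^ ((n + 1) * (n + 1)) * (f * c ^ (n + 1) * l ^ 2))) * q ^ n := by
    calc _ ≤ M * R * (c * (P * q ^ n)) := by gcongr
      _ = (c * M) * (P * R) * q ^ n := by ring
      _ ≤ (m * (q ^ (n * ((n + 1) * (n + 1))) * l)) *
        (l ^ 2 * (G * (f * c ^ (n + 1) * l ^ 2))) * q ^ n := by gcongr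
      _ ≤ _ := by gcongr
  have h10 : 0 < l ^ (2 * n + 7) * c ^ (n + 1) := by positivity
  have h11 : q ^ (n * ((n + 1) * (n + 1))) * q ^ ((n + 1) * (n + 1))
      = l ^ (2 * n + 2) * q ^ ((n + 1) * (n + 1)) := by
    calc q ^ (n * ((n + 1) * (n + 1))) * q ^ ((n + 1) * (n + 1))
        = (q ^ ((n + 1) * (n + 1))) ^ (n + 1) := by ring
      _ = (l ^ 2 * q ^ (n + 1)) ^ (n + 1) := by rw [h7]
      _ = l ^ (2 * n + 2) * q ^ ((n + 1) * (n + 1)) := by ring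
  refine le_of_mul_le_mul_left ?_ h10
  calc _ = (l ^ n * K ^ (n + 1) * (l * (l * (c ^ (n + 1) * l)))) ^ 2 * (c * (c ^ n * l)) := by ring
    _ ≤ _ := h9
    _ = (q ^ (n * ((n + 1) * (n + 1))) * q ^ ((n + 1) * (n + 1)))
        * (m * f * c ^ (n + 1) * l ^ 5 * q ^ n) := by ring
    _ = _ := by rw [h11, pow_add q]; ring

lemma norm_kloosterman_pow_le {ψ : AddChar F ℂ} (hψ : ψ ≠ 0) (hn : 0 < n) :
    (Fintype.card Fˣ : ℝ) ^ (2 * (n + 1)) * ‖kloosterman ψ n 1‖ ^ (2 * (n + 1))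
      ≤ n * (n + 1).factorial * (Fintype.card F : ℝ) ^ ((n + 1) * (n + 1) + n) := by
  have h1 := norm_ip_whittakerIter_ge (N := n + 1) (n := n) hψ
  have h2 := norm_ip_whittakerIter_sq_le (N := n + 1) (n := n) ψ
  have h3 := sum_norm_whittakerIter_det_one_le (n := n) hψ hn
  have h4 := sum_norm_rightAvg_conjCount_le (n := n) hψ
  have h5 : (Fintype.card Fˣ : ℝ) ^ n * Fintype.card (uni F (N := n + 1) (· > ·))
      ≤ #{p : GL (Fin (n + 1)) F | p ∈ lowerMirabolic F n} * (Fintype.card F : ℝ) ^ n := by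
    exact_mod_cast card_lowerMirabolic_ge (F := F) (n := n)
  have h6 : (Fintype.card (GL (Fin (n + 1)) F) : ℝ)
      ≤ (Fintype.card F : ℝ) ^ ((n + 1) * (n + 1)) := by
    exact_mod_cast card_GL_le (F := F) (N := n + 1)
  have h7 : (Fintype.card (uni F (N := n + 1) (· > ·)) : ℝ) ^ 2 * (Fintype.card F : ℝ) ^ (n + 1)
      = (Fintype.card F : ℝ) ^ ((n + 1) * (n + 1)) := by
    rw [← two_mul_card_gt_pairs (n + 1), pow_add _ (2 * _), mul_comm 2, pow_mul, card_uni_gt]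
    push_cast
    rfl
  rw [card_uni_lt] at h3 h4
  exact pow_mul_pow_le_of_chain (Nat.cast_nonneg n) (Nat.cast_nonneg _)
    (by exact_mod_cast Fintype.card_pos) (by exact_mod_cast Fintype.card_pos) (Nat.cast_nonneg _)
    (Nat.cast_nonneg _) (norm_nonneg _)
    (Finset.sum_nonneg fun x _ => by split_ifs <;> positivity)
    (Finset.sum_nonneg fun x _ => by positivity) h1 h2 h3 h4 h5 h6 h7

end Kloosterman
end GaussEquidist

namespace GaussEquidist
section GaussSums
open scoped Classical ComplexConjugate
open Finset

lemma sum_units_mul_eq_gaussSum {F : Type*} [Field F] [Fintype F] (ψ : AddChar F ℂ)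
    (χ : MulChar F ℂ) : ∑ a : Fˣ, ψ a * χ a = gaussSum χ ψ := by
  unfold gaussSum
  refine Fintype.sum_of_injective Units.val Units.val_injective _ _ (fun a ha => ?_)
    fun a => mul_comm _ _
  rw [χ.map_nonunit fun h => ha ⟨h.unit, rfl⟩, zero_mul]

lemma sum_conv_mul {G : Type*} [Group G] [Fintype G] (w φ : G → ℂ) (η : G →* ℂ) :
    ∑ x, conv w φ x * η x = (∑ x, w x * η x) * ∑ x, φ x * η x := by
  simp only [conv, Finset.sum_mul]
  rw [Finset.sum_comm]
  refine Finset.sum_congr rfl fun g _ => ?_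
  rw [← Equiv.sum_comp (Equiv.mulLeft g), Finset.mul_sum]
  refine Finset.sum_congr rfl fun x _ => ?_
  simp only [Equiv.coe_mulLeft, inv_mul_cancel_left, map_mul]
  ring

lemma sum_kloosterman_mul {F : Type*} [Field F] [Fintype F] (ψ : AddChar F ℂ)
    (χ : MulChar F ℂ) (n : ℕ) : ∑ a : Fˣ, kloosterman ψ n a * χ a = gaussSum χ ψ ^ n := by
  induction n with
  | zero => simp [kloosterman, Pi.single_apply]
  | succ n ih =>
    have h := sum_conv_mul (fun s : Fˣ => ψ s) (kloosterman ψ n)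
      ((χ : F →* ℂ).comp (Units.coeHom F))
    simp only [MonoidHom.comp_apply, Units.coeHom_apply, MonoidHom.coe_coe] at h
    rw [ih, sum_units_mul_eq_gaussSum] at h
    rw [pow_succ', ← h]
    simp only [kloosterman, Function.iterate_succ_apply']

/-- The nontrivial Dirichlet characters modulo `q`. -/
def NontrivialChar (q : ℕ) : Type := {χ : DirichletCharacter ℂ q // χ ≠ 1}

noncomputable instance (q : ℕ) : Fintype (NontrivialChar q) :=
  inferInstanceAs (Fintype {χ : DirichletCharacter ℂ q // χ ≠ 1})

variable {q : ℕ} [Fact q.Prime]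

lemma sum_gaussSum_pow (ψ : AddChar (ZMod q) ℂ) (n : ℕ) :
    ∑ χ : DirichletCharacter ℂ q, gaussSum χ ψ ^ n
      = q.totient * kloosterman ψ n 1 := by
  simp only [← sum_kloosterman_mul]
  rw [Finset.sum_comm]
  simp only [← Finset.mul_sum, DirichletCharacter.sum_characters_eq, Units.val_eq_one]
  simp [mul_comm]

lemma normGaussSum_eq (χ : DirichletCharacter ℂ q) :
    normGaussSum q χ = (Real.sqrt q : ℂ)⁻¹ * gaussSum χ ZMod.stdAddChar := by
  unfold normGaussSum gaussSum
  congr 1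
  refine Finset.sum_bij' (fun x _ => (x : ZMod q)) (fun x _ => x.val) (fun _ _ => Finset.mem_univ _)
    (fun x _ => Finset.mem_range.2 (ZMod.val_lt x))
    (fun x hx => ZMod.val_cast_of_lt (Finset.mem_range.1 hx))
    (fun x _ => ZMod.natCast_zmod_val x) fun x _ => ?_
  have h := ZMod.stdAddChar_coe (N := q) x
  rw [Int.cast_natCast] at h
  rw [h, Int.cast_natCast, mul_div_assoc]

lemma norm_normGaussSum {χ : DirichletCharacter ℂ q} (hχ : χ ≠ 1) : ‖normGaussSum q χ‖ = 1 := by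
  have hq : (0 : ℝ) < q := by exact_mod_cast (Fact.out : q.Prime).pos
  have h := gaussSum_mul_gaussSum_eq_card hχ (ZMod.isPrimitive_stdAddChar q)
  rw [← star_gaussSum_eq, ← starRingEnd_apply, Complex.mul_conj, Complex.normSq_eq_norm_sq,
    ZMod.card] at h
  have h1 : ‖gaussSum χ (ZMod.stdAddChar (N := q))‖ ^ 2 = (q : ℝ) := by exact_mod_cast h
  have h2 : ‖gaussSum χ (ZMod.stdAddChar (N := q))‖ = Real.sqrt q := by
    rw [← h1, Real.sqrt_sq (norm_nonneg _)]
  rw [normGaussSum_eq, norm_mul, norm_inv, Complex.norm_real, Real.norm_eq_abs,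
    abs_of_nonneg (Real.sqrt_nonneg _), h2]
  exact inv_mul_cancel₀ (Real.sqrt_pos.2 hq).ne'

lemma stdAddChar_ne_one : (ZMod.stdAddChar : AddChar (ZMod q) ℂ) ≠ 1 := by
  have h := ZMod.isPrimitive_stdAddChar q one_ne_zero
  rwa [AddChar.mulShift_one] at h

lemma norm_sum_normGaussSum_pow_le (n : ℕ) :
    ‖∑ χ : NontrivialChar q, normGaussSum q χ.1 ^ n‖
      ≤ (Real.sqrt q)⁻¹ ^ n * (q.totient
        * ‖kloosterman (ZMod.stdAddChar : AddChar (ZMod q) ℂ) n 1‖) + 1 := by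
  have hq : (1 : ℝ) ≤ q := by exact_mod_cast (Fact.out : q.Prime).one_le
  have h1 : ∑ χ : NontrivialChar q, normGaussSum q χ.1 ^ n
      = (Real.sqrt q : ℂ)⁻¹ ^ n * (q.totient
        * kloosterman (ZMod.stdAddChar : AddChar (ZMod q) ℂ) n 1 - (-1) ^ n) := by
    rw [← sum_gaussSum_pow, ← gaussSum_one_left (R := ZMod q) stdAddChar_ne_one,
      Fintype.sum_eq_add_sum_subtype_ne _ (1 : DirichletCharacter ℂ q), add_sub_cancel_left,
      Finset.mul_sum]
    simp only [normGaussSum_eq, mul_pow]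
    let e : NontrivialChar q ≃ {χ : DirichletCharacter ℂ q // χ ≠ 1} := Equiv.refl _
    exact Fintype.sum_equiv e _ _ fun _ => rfl
  have h2 : (Real.sqrt q)⁻¹ ^ n ≤ 1 :=
    pow_le_one₀ (by positivity) (inv_le_one_of_one_le₀ (Real.one_le_sqrt.2 hq))
  rw [h1, norm_mul, norm_pow, norm_inv, Complex.norm_real, Real.norm_eq_abs,
    abs_of_nonneg (Real.sqrt_nonneg _)]
  calc _ ≤ (Real.sqrt q)⁻¹ ^ n * (‖(q.totient : ℂ)
        * kloosterman (ZMod.stdAddChar : AddChar (ZMod q) ℂ) n 1‖ + 1) := by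
        gcongr
        refine (norm_sub_le _ _).trans_eq ?_
        simp
    _ ≤ _ := by
        rw [mul_add, norm_mul, Complex.norm_natCast, mul_one]
        gcongr

lemma norm_sum_normGaussSum_pow_div_le {n : ℕ} (hn : 0 < n) :
    ‖∑ χ : NontrivialChar q, normGaussSum q χ.1 ^ n‖ / q
      ≤ ((n * (n + 1).factorial : ℝ) / q) ^ ((2 * (n + 1) : ℕ) : ℝ)⁻¹ + 1 / q := by
  have hq : (0 : ℝ) < q := by exact_mod_cast (Fact.out : q.Prime).pos
  set T : ℝ := (Real.sqrt q)⁻¹ ^ n * (q.totient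
        * ‖kloosterman (ZMod.stdAddChar : AddChar (ZMod q) ℂ) n 1‖) with hT
  have hT0 : 0 ≤ T := by positivity
  refine (div_le_div_of_nonneg_right (norm_sum_normGaussSum_pow_le n) hq.le).trans ?_
  rw [add_div]
  gcongr
  rw [← hT]
  have h1 := norm_kloosterman_pow_le (F := ZMod q) (n := n) stdAddChar_ne_one hn
  rw [ZMod.card, ZMod.card_units_eq_totient] at h1
  have h2 : (T / q) ^ (2 * (n + 1)) ≤ (n * (n + 1).factorial : ℝ) / q := by
    have h3 : (Real.sqrt q ^ n) ^ (2 * (n + 1)) = (q : ℝ) ^ (n * (n + 1)) := by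
      rw [← pow_mul, show n * (2 * (n + 1)) = 2 * (n * (n + 1)) by ring, pow_mul,
        Real.sq_sqrt hq.le]
    rw [hT, div_pow, mul_pow, mul_pow, inv_pow, inv_pow, h3, div_le_div_iff₀ (by positivity) hq]
    calc _ ≤ ((q : ℝ) ^ (n * (n + 1)))⁻¹ * (n * (n + 1).factorial
          * (q : ℝ) ^ ((n + 1) * (n + 1) + n)) * q :=
        mul_le_mul_of_nonneg_right (mul_le_mul_of_nonneg_left h1 (by positivity)) hq.le
      _ = (n * (n + 1).factorial : ℝ) * q ^ (2 * (n + 1)) := by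
        rw [show (n + 1) * (n + 1) + n = n * (n + 1) + (2 * n + 1) by ring, pow_add]
        field_simp
        ring
  rw [← Real.pow_rpow_inv_natCast (n := 2 * (n + 1)) (div_nonneg hT0 hq.le) (by positivity)]
  gcongr

lemma card_ne_one_add_two :
    Fintype.card (NontrivialChar q) + 2 = q := by
  have h1 := DirichletCharacter.card_eq_totient_of_hasEnoughRootsOfUnity ℂ q
  rw [Nat.card_eq_fintype_card, Nat.totient_prime Fact.out] at h1
  have h2 := Fintype.card_subtype_compl fun χ : DirichletCharacter ℂ q => χ = 1
  rw [Fintype.card_subtype_eq, h1] at h2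
  have h3 := (Fact.out : q.Prime).two_le
  have h4 : Fintype.card (NontrivialChar q) = q - 1 - 1 := by
    rw [← h2]
    exact Fintype.card_congr (Equiv.refl _)
  omega

end GaussSums
end GaussEquidist

namespace GaussEquidist
section Weyl
open scoped Classical ComplexConjugate Topology BoundedContinuousFunction
open Finset Filter MeasureTheory AddCircle

lemma norm_average_le {Y : Type*} [Fintype Y] [Nonempty Y] {f : Y → ℂ} {c : ℝ}
    (hf : ∀ k, ‖f k‖ ≤ c) : ‖(∑ k, f k) / Fintype.card Y‖ ≤ c := by
  rw [norm_div, Complex.norm_natCast, div_le_iff₀ (by exact_mod_cast Fintype.card_pos), mul_comm]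
  refine (norm_sum_le _ _).trans ((Finset.sum_le_card_nsmul _ _ c fun k _ => hf k).trans_eq ?_)
  simp

variable {T : ℝ}

/-- The uniform probability measure on the values of a finite family. -/
noncomputable def empiricalMeasure {Y : Type*} [Fintype Y] (y : Y → AddCircle T) :
    Measure (AddCircle T) :=
  ∑ k, (Fintype.card Y : ENNReal)⁻¹ • Measure.dirac (y k)

lemma empiricalMeasure_apply {Y : Type*} [Fintype Y] (y : Y → AddCircle T)
    {E : Set (AddCircle T)}
    (hE : MeasurableSet E) :
    empiricalMeasure y E = #{k | y k ∈ E} / (Fintype.card Y : ENNReal) := by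
  simp only [empiricalMeasure, Measure.coe_finsetSum, Finset.sum_apply, Measure.smul_apply,
    Measure.dirac_apply' _ hE, smul_eq_mul, ← Finset.mul_sum, Set.indicator_apply, Pi.one_apply,
    Finset.sum_boole]
  rw [mul_comm, div_eq_mul_inv]

lemma isProbabilityMeasure_empiricalMeasure {Y : Type*} [Fintype Y] [Nonempty Y]
    (y : Y → AddCircle T) : IsProbabilityMeasure (empiricalMeasure y) := by
  refine ⟨?_⟩
  rw [empiricalMeasure_apply y MeasurableSet.univ]
  simp only [Set.mem_univ, Finset.filter_true, Finset.card_univ]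
  exact ENNReal.div_self (by simp) (by simp)

lemma integral_empiricalMeasure {Y : Type*} [Fintype Y] [Nonempty Y] (y : Y → AddCircle T)
    (f : C(AddCircle T, ℂ)) :
    ∫ t, f t ∂empiricalMeasure y = (∑ k, f (y k)) / (Fintype.card Y : ℂ) := by
  have hc : (Fintype.card Y : ENNReal) ≠ 0 := by simp
  rw [empiricalMeasure, integral_finsetSum_measure]
  · simp only [integral_smul_measure, integral_dirac, ← Finset.smul_sum]
    simp [div_eq_inv_mul]
  · intro k _
    exact (integrable_dirac (by simp)).smul_measure (by simp)

lemma isOpen_image_Ioo (a b : ℝ) : IsOpen ((↑) '' Set.Ioo a b : Set (AddCircle T)) :=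
  QuotientAddGroup.isOpenMap_coe _ isOpen_Ioo

lemma image_Ico_eq {a b : ℝ} (hab : a < b) :
    ((↑) '' Set.Ico a b : Set (AddCircle T)) = insert (a : AddCircle T) ((↑) '' Set.Ioo a b) := by
  rw [← Set.Ioo_insert_left hab, Set.image_insert_eq]

lemma measurableSet_image_Ico {a b : ℝ} (hab : a < b) :
    MeasurableSet ((↑) '' Set.Ico a b : Set (AddCircle T)) := by
  rw [image_Ico_eq hab]
  exact (isOpen_image_Ioo a b).measurableSet.insert _

variable [hT : Fact (0 < T)]

lemma integral_fourier {n : ℤ} (hn : n ≠ 0) :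
    ∫ t, fourier n t ∂(haarAddCircle : Measure (AddCircle T)) = 0 :=
  integral_eq_zero_of_add_right_eq_neg (fourier_add_half_inv_index hn hT.out)

lemma haarAddCircle_singleton (t : AddCircle T) :
    (haarAddCircle : Measure (AddCircle T)) {t} = 0 := by
  have h : (volume : Measure (AddCircle T)) {t} = 0 := by
    rw [add_projection_respects_measure T 0 (measurableSet_singleton t)]
    refine Set.Subsingleton.measure_zero (fun u hu v hv => ?_) _
    exact (coe_eq_coe_iff_of_mem_Ioc hu.2 hv.2).1 (hu.1.trans hv.1.symm)
  rw [volume_eq_smul_haarAddCircle, Measure.smul_apply, smul_eq_mul, mul_eq_zero] at h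
  exact h.resolve_left (ENNReal.ofReal_pos.2 hT.out).ne'

lemma haarAddCircle_frontier_image_Ico {a b : ℝ} (hab : a < b) :
    (haarAddCircle : Measure (AddCircle T)) (frontier ((↑) '' Set.Ico a b)) = 0 := by
  have h1 : frontier ((↑) '' Set.Ico a b : Set (AddCircle T))
      ⊆ {(a : AddCircle T)} ∪ {(b : AddCircle T)} := by
    have h2 : closure ((↑) '' Set.Ico a b : Set (AddCircle T)) ⊆ (↑) '' Set.Icc a b :=
      closure_minimal (Set.image_mono Set.Ico_subset_Icc_self)
        (isCompact_Icc.image (AddCircle.continuous_mk' T)).isClosed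
    have h3 : ((↑) '' Set.Ioo a b : Set (AddCircle T)) ⊆ interior ((↑) '' Set.Ico a b) :=
      interior_maximal (Set.image_mono Set.Ioo_subset_Ico_self) (isOpen_image_Ioo a b)
    rintro t ⟨ht, ht'⟩
    obtain ⟨s, hs, rfl⟩ := h2 ht
    by_contra hne
    simp only [Set.mem_union, Set.mem_singleton_iff, not_or] at hne
    refine ht' (h3 ⟨s, ⟨hs.1.lt_of_ne ?_, hs.2.lt_of_ne ?_⟩, rfl⟩)
    · rintro rfl
      exact hne.1 rfl
    · rintro rfl
      exact hne.2 rfl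
  exact measure_mono_null h1
    (measure_union_null (haarAddCircle_singleton _) (haarAddCircle_singleton _))

lemma haarAddCircle_real_image_Ico {a b : ℝ} (hab : a < b) (hb : b ≤ a + T) :
    (haarAddCircle : Measure (AddCircle T)).real ((↑) '' Set.Ico a b) = (b - a) / T := by
  have h1 : (haarAddCircle : Measure (AddCircle T)).real ((↑) '' Set.Ico a b)
      = (haarAddCircle : Measure (AddCircle T)).real ((↑) '' Set.Ioo a b) := by
    rw [image_Ico_eq hab, Set.insert_eq]
    refine congrArg ENNReal.toReal (le_antisymm ?_ (measure_mono Set.subset_union_right))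
    refine (measure_union_le _ _).trans ?_
    rw [haarAddCircle_singleton, zero_add]
  have h2 : ((↑) : ℝ → AddCircle T) ⁻¹' ((↑) '' Set.Ioo a b) ∩ Set.Ioc a (a + T)
      = Set.Ioo a b := by
    ext t
    constructor
    · rintro ⟨⟨s, hs, hst⟩, ht⟩
      rwa [← (coe_eq_coe_iff_of_mem_Ioc ⟨hs.1, hs.2.le.trans hb⟩ ht).1 hst]
    · exact fun ht => ⟨⟨t, ht, rfl⟩, ht.1, ht.2.le.trans hb⟩
  have h3 := add_projection_respects_measure T a (isOpen_image_Ioo a b).measurableSet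
  have h4 := congrArg ENNReal.toReal (h3.trans (congrArg volume h2))
  rw [volume_eq_smul_haarAddCircle, Measure.smul_apply, smul_eq_mul, ENNReal.toReal_mul,
    ENNReal.toReal_ofReal hT.out.le, Real.volume_Ioo, ENNReal.toReal_ofReal (by linarith)] at h4
  rw [h1, eq_div_iff hT.out.ne', mul_comm]
  exact h4

variable {ι : Type*} {L : Filter ι} {X : ι → Type*}
  [∀ i, Fintype (X i)] [∀ i, Nonempty (X i)] {x : ∀ i, X i → AddCircle T}

lemma tendsto_average_of_tendsto_fourier
    (h : ∀ n : ℤ, n ≠ 0 → Tendsto (fun i => (∑ k, fourier n (x i k)) / (Fintype.card (X i) : ℂ)) L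
      (𝓝 0)) (f : C(AddCircle T, ℂ)) :
    Tendsto (fun i => (∑ k, f (x i k)) / (Fintype.card (X i) : ℂ)) L
      (𝓝 (∫ t, f t ∂haarAddCircle)) := by
  have hint : ∀ g : C(AddCircle T, ℂ), Integrable g (haarAddCircle : Measure (AddCircle T)) :=
    fun g => g.continuous.integrable_of_hasCompactSupport (HasCompactSupport.of_compactSpace _)
  have hspan : ∀ g ∈ Submodule.span ℂ (Set.range (@fourier T)),
      Tendsto (fun i => (∑ k, g (x i k)) / (Fintype.card (X i) : ℂ)) L
        (𝓝 (∫ t, g t ∂haarAddCircle)) := by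
    intro g hg
    induction hg using Submodule.span_induction with
    | mem g hg =>
      obtain ⟨n, rfl⟩ := hg
      by_cases hn : n = 0
      · subst hn
        simp [tendsto_const_nhds]
      · rw [integral_fourier hn]
        exact h n hn
    | zero => simp [tendsto_const_nhds]
    | add g₁ g₂ _ _ h₁ h₂ =>
      simpa [Finset.sum_add_distrib, add_div, integral_add (hint g₁) (hint g₂)] using h₁.add h₂
    | smul c g _ h₁ =>
      simpa [← Finset.mul_sum, mul_div_assoc, integral_const_mul] using h₁.const_mul c
  rw [Metric.tendsto_nhds]
  intro ε hε
  have hf : f ∈ closure (Submodule.span ℂ (Set.range (@fourier T)) : Set C(AddCircle T, ℂ)) := by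
    rw [← Submodule.topologicalClosure_coe, span_fourier_closure_eq_top]
    trivial
  obtain ⟨g, hg, hfg⟩ := Metric.mem_closure_iff.1 hf (ε / 3) (by positivity)
  have hle : ∀ t, ‖f t - g t‖ ≤ ε / 3 := fun t => by
    rw [← dist_eq_norm]
    exact (ContinuousMap.dist_apply_le_dist t).trans hfg.le
  filter_upwards [Metric.tendsto_nhds.1 (hspan g hg) (ε / 3) (by positivity)] with i hi
  have h1 : dist ((∑ k, f (x i k)) / (Fintype.card (X i) : ℂ))
      ((∑ k, g (x i k)) / (Fintype.card (X i) : ℂ)) ≤ ε / 3 := by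
    rw [dist_eq_norm, ← sub_div, ← Finset.sum_sub_distrib]
    exact norm_average_le fun k => hle _
  have h2 : dist (∫ t, g t ∂(haarAddCircle : Measure (AddCircle T)))
      (∫ t, f t ∂haarAddCircle) ≤ ε / 3 := by
    rw [dist_comm, dist_eq_norm, ← integral_sub (hint f) (hint g)]
    refine (norm_integral_le_of_norm_le_const (ae_of_all _ hle)).trans_eq ?_
    simp
  have h3 := dist_triangle4 ((∑ k, f (x i k)) / (Fintype.card (X i) : ℂ))
    ((∑ k, g (x i k)) / (Fintype.card (X i) : ℂ)) (∫ t, g t ∂haarAddCircle)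
    (∫ t, f t ∂haarAddCircle)
  linarith

lemma tendsto_card_div_of_tendsto_fourier
    (h : ∀ n : ℤ, n ≠ 0 → Tendsto (fun i => (∑ k, fourier n (x i k)) / (Fintype.card (X i) : ℂ)) L
      (𝓝 0)) {E : Set (AddCircle T)} (hE : MeasurableSet E)
    (hE' : (haarAddCircle : Measure (AddCircle T)) (frontier E) = 0) :
    Tendsto (fun i => (#{k | x i k ∈ E} : ℝ) / Fintype.card (X i)) L
      (𝓝 ((haarAddCircle : Measure (AddCircle T)).real E)) := by
  let μ : ι → ProbabilityMeasure (AddCircle T) := fun i =>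
    ⟨empiricalMeasure (x i), isProbabilityMeasure_empiricalMeasure (x i)⟩
  let μ₀ : ProbabilityMeasure (AddCircle T) := ⟨haarAddCircle, inferInstance⟩
  have hlim : Tendsto μ L (𝓝 μ₀) := by
    rw [ProbabilityMeasure.tendsto_iff_forall_integral_rclike_tendsto ℂ]
    intro f
    refine (tendsto_average_of_tendsto_fourier h f.toContinuousMap).congr fun i => ?_
    exact (integral_empiricalMeasure (x i) f.toContinuousMap).symm
  have h1 := ProbabilityMeasure.tendsto_measure_of_null_frontier_of_tendsto' hlim hE'
  have h2 := (ENNReal.tendsto_toReal (measure_ne_top haarAddCircle E)).comp h1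
  refine h2.congr fun i => ?_
  have h3 : (μ i : Measure (AddCircle T)) E = _ := empiricalMeasure_apply (x i) hE
  rw [Function.comp_apply, h3]
  simp

end Weyl
end GaussEquidist

namespace GaussEquidist
section Equidistribution
open scoped Classical ComplexConjugate Topology
open Finset Filter AddCircle

lemma two_pi_fact : Fact (0 < 2 * Real.pi) := ⟨Real.two_pi_pos⟩

lemma fourier_coe_arg {z : ℂ} (hz : ‖z‖ = 1) (n : ℕ) :
    fourier n (z.arg : AddCircle (2 * Real.pi)) = z ^ n := by
  have h := Complex.norm_mul_exp_arg_mul_I z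
  rw [hz, Complex.ofReal_one, one_mul] at h
  conv_rhs => rw [← h, ← Complex.exp_nat_mul]
  rw [fourier_coe_apply]
  congr 1
  have := Real.pi_ne_zero
  push_cast
  field_simp

lemma norm_sum_fourier_coe_arg {Y : Type*} [Fintype Y] {z : Y → ℂ} (hz : ∀ k, ‖z k‖ = 1) (n : ℤ) :
    ‖∑ k, fourier n ((z k).arg : AddCircle (2 * Real.pi))‖ = ‖∑ k, z k ^ n.natAbs‖ := by
  have h : ∀ m : ℕ, ∑ k, fourier m ((z k).arg : AddCircle (2 * Real.pi)) = ∑ k, z k ^ m :=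
    fun m => Finset.sum_congr rfl fun k _ => fourier_coe_arg (hz k) m
  obtain hn | hn := Int.natAbs_eq n
  · rw [hn, h, Int.natAbs_natCast]
  · rw [hn, Int.natAbs_neg, Int.natAbs_natCast, ← h]
    simp only [fourier_neg]
    rw [← map_sum, RCLike.norm_conj]

lemma coe_arg_mem_image {z : ℂ} (hz : ‖z‖ = 1) (s : Set ℝ) :
    (z.arg : AddCircle (2 * Real.pi)) ∈ ((↑) '' s : Set (AddCircle (2 * Real.pi)))
      ↔ ∃ θ ∈ s, z = Complex.exp ((θ : ℂ) * Complex.I) := by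
  have h1 : (toCircle (z.arg : AddCircle (2 * Real.pi)) : ℂ) = z := by
    rw [← fourier_one, ← pow_one z]
    simpa using fourier_coe_arg hz 1
  have h2 : ∀ θ : ℝ, (toCircle (θ : AddCircle (2 * Real.pi)) : ℂ) = Complex.exp (θ * Complex.I) :=
    fun θ => by
      rw [← fourier_one, fourier_coe_apply]
      congr 1
      have := Real.pi_ne_zero
      push_cast
      field_simp
  simp only [Set.mem_image]
  refine exists_congr fun θ => and_congr_right fun _ => ?_
  rw [← h2, ← (injective_toCircle Real.two_pi_pos.ne').eq_iff, ← Circle.coe_inj, h1, eq_comm]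

/-- The primes greater than two. -/
abbrev OddPrime : Type := {q : ℕ // q.Prime ∧ 2 < q}

lemma tendsto_average_normGaussSum_pow {n : ℕ} (hn : 0 < n) :
    Tendsto (fun q : OddPrime =>
      ‖∑ χ : NontrivialChar q, normGaussSum q χ.1 ^ n‖
        / Fintype.card (NontrivialChar q)) (comap Subtype.val atTop) (𝓝 0) := by
  have hlim : Tendsto (fun q : ℕ => 3 * (((n * (n + 1).factorial : ℝ) / q)
      ^ ((2 * (n + 1) : ℕ) : ℝ)⁻¹ + 1 / q)) atTop (𝓝 0) := by
    have h1 := (tendsto_const_div_atTop_nhds_zero_nat (n * (n + 1).factorial : ℝ)).rpow_const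
      (p := ((2 * (n + 1) : ℕ) : ℝ)⁻¹) (Or.inr (by positivity))
    rw [Real.zero_rpow (by positivity)] at h1
    simpa using (h1.add (tendsto_const_div_atTop_nhds_zero_nat 1)).const_mul 3
  refine squeeze_zero (fun q => by positivity) (fun q => ?_) (hlim.comp tendsto_comap)
  have hq : Fact (q : ℕ).Prime := ⟨q.2.1⟩
  have h1 : ((Fintype.card (NontrivialChar q) : ℕ) : ℝ) + 2 = (q : ℕ) := by
    exact_mod_cast card_ne_one_add_two (q := q)
  have h2 : (3 : ℝ) ≤ (q : ℕ) := by exact_mod_cast q.2.2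
  have h3 := norm_sum_normGaussSum_pow_div_le (q := q) hn
  refine le_trans ?_ (mul_le_mul_of_nonneg_left h3 (by norm_num))
  rw [← mul_div_assoc, div_le_div_iff₀ (by linarith) (by linarith)]
  nlinarith [norm_nonneg (∑ χ : NontrivialChar q, normGaussSum q χ.1 ^ n)]

lemma tendsto_card_normGaussSum_mem_arc {a b : ℝ} (hab : a < b) (hb : b ≤ a + 2 * Real.pi) :
    Tendsto (fun q : OddPrime => (#{χ : NontrivialChar q |
        ∃ θ ∈ Set.Ico a b, normGaussSum q χ.1 = Complex.exp ((θ : ℂ) * Complex.I)} : ℝ)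
        / Fintype.card (NontrivialChar q)) (comap Subtype.val atTop)
      (𝓝 ((b - a) / (2 * Real.pi))) := by
  have := two_pi_fact
  have hprime : ∀ q : OddPrime, Fact (q : ℕ).Prime := fun q => ⟨q.2.1⟩
  have hne : ∀ q : OddPrime, Nonempty (NontrivialChar q) := fun q => by
    rw [← Fintype.card_pos_iff]
    have := card_ne_one_add_two (q := q)
    have := q.2.2
    omega
  have hnorm : ∀ (q : OddPrime) (χ : NontrivialChar q),
      ‖normGaussSum q χ.1‖ = 1 := fun q χ => norm_normGaussSum χ.2
  rw [← haarAddCircle_real_image_Ico hab hb]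
  refine (tendsto_card_div_of_tendsto_fourier
    (x := fun (q : OddPrime) (χ : NontrivialChar q) =>
      ((normGaussSum q χ.1).arg : AddCircle (2 * Real.pi))) (fun n hn => ?_)
    (measurableSet_image_Ico hab) (haarAddCircle_frontier_image_Ico hab)).congr fun q => ?_
  · rw [tendsto_zero_iff_norm_tendsto_zero]
    refine (tendsto_average_normGaussSum_pow (Int.natAbs_pos.2 hn)).congr fun q => ?_
    rw [norm_div, norm_sum_fourier_coe_arg (hnorm q), Complex.norm_natCast]
  · simp only [coe_arg_mem_image (hnorm _ _)]

end Equidistribution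
end GaussEquidist

/-- Equidistribution of the normalized Gauss sums of the nontrivial Dirichlet characters
modulo a prime `q` on the unit circle, with respect to the uniform measure,
as `q → ∞` over the primes. -/
theorem stmt_3 (a b : ℝ) (ha : 0 ≤ a) (hab : a < b) (hb : b ≤ 2 * Real.pi)
    (ε : ℝ) (hε : 0 < ε) :
    ∃ Q : ℕ, ∀ q : ℕ, q.Prime → Q ≤ q →
      |(Nat.card {χ : DirichletCharacter ℂ q //
            χ ≠ 1 ∧ ∃ θ ∈ Set.Ico a b, normGaussSum q χ = Complex.exp ((θ : ℂ) * Complex.I)} : ℝ)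
          / ((q : ℝ) - 2) - (b - a) / (2 * Real.pi)| < ε := by
  classical
  have h := GaussEquidist.tendsto_card_normGaussSum_mem_arc hab (by linarith : b ≤ a + 2 * Real.pi)
  have h' := Filter.eventually_comap.1 (Metric.tendsto_nhds.1 h ε hε)
  obtain ⟨Q, hQ⟩ := Filter.eventually_atTop.1 h'
  refine ⟨max Q 3, fun q hq hqQ => ?_⟩
  have hfact : Fact q.Prime := ⟨hq⟩
  have h1 := hQ q (le_of_max_le_left hqQ) ⟨q, hq, le_of_max_le_right hqQ⟩ rfl
  have h2 : (Fintype.card (GaussEquidist.NontrivialChar q) : ℝ) = (q : ℝ) - 2 := by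
    rw [eq_sub_iff_add_eq]
    exact_mod_cast GaussEquidist.card_ne_one_add_two (q := q)
  rw [Real.dist_eq] at h1
  convert h1 using 4
  · rw [← Fintype.card_subtype, ← Nat.card_eq_fintype_card]
    exact_mod_cast Nat.card_congr (Equiv.subtypeSubtypeEquivSubtypeInter _ _).symm
  · rw [← h2]
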